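/- arXiv:2404.04700 — 7 statements merged into one kernel-verified Lean document; each statement's English description precedes it below -/
import Mathlib

section
/- Under the stratification assumption, for every measurable φ : ℝ × {0,1} × {0,1} → ℝ such that φ(Y,Z,D) is P-integrable and W·φ(Y,Z,D) is P*-integrable, one has E_P[φ(Y,Z,D)] = E_{P*}[W · φ(Y,Z,D)]. -/
open MeasureTheory

theorem aux_strat {Ω : Type*} [MeasurableSpace Ω]
    (P Ps : Measure Ω) [IsProbabilityMeasure P] [IsProbabilityMeasure Ps]
    (D Y Z : Ω → ℝ) (hD : Measurable D) (hY : Measurable Y) (hZ : Measurable Z)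
    (d p ps : ℝ) (hp : 0 < p) (hps : 0 < ps)
    (hs : ∀ f : ℝ × ℝ → ℝ, Measurable f → (∃ C, ∀ p, |f p| ≤ C) →
      (∫ ω, (if D ω = d then (1 : ℝ) else 0) * f (Y ω, Z ω) ∂P) / p =
        (∫ ω, (if D ω = d then (1 : ℝ) else 0) * f (Y ω, Z ω) ∂Ps) / ps)
    (g : ℝ × ℝ → ℝ) (hg : Measurable g) :
    ∫ ω in {ω | D ω = d}, g (Y ω, Z ω) ∂P =
      (p / ps) * ∫ ω in {ω | D ω = d}, g (Y ω, Z ω) ∂Ps := by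
  have hS : MeasurableSet {ω | D ω = d} := hD (measurableSet_singleton d)
  have hYZ : Measurable (fun ω => (Y ω, Z ω)) := hY.prodMk hZ
  have key : (P.restrict {ω | D ω = d}).map (fun ω => (Y ω, Z ω)) =
      ENNReal.ofReal (p / ps) • (Ps.restrict {ω | D ω = d}).map (fun ω => (Y ω, Z ω)) := by
    ext A hA
    have h := hs (A.indicator 1) (measurable_one.indicator hA) ⟨1, fun q => by
      by_cases hq : q ∈ A <;> simp [hq]⟩
    have e : ∀ μ : Measure Ω, ∫ ω, (if D ω = d then (1 : ℝ) else 0) *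
        (A.indicator (1 : ℝ × ℝ → ℝ)) (Y ω, Z ω) ∂μ =
        μ.real ((fun ω => (Y ω, Z ω)) ⁻¹' A ∩ {ω | D ω = d}) := by
      intro μ
      rw [← integral_indicator_one ((hYZ hA).inter hS)]
      congr 1
      ext ω
      by_cases h1 : D ω = d <;> by_cases h2 : (Y ω, Z ω) ∈ A <;>
        simp [Set.indicator, h1, h2]
    rw [e, e] at h
    rw [Measure.smul_apply, Measure.map_apply hYZ hA, Measure.map_apply hYZ hA,
      Measure.restrict_apply (hYZ hA), Measure.restrict_apply (hYZ hA), smul_eq_mul,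
      ← ENNReal.ofReal_toReal (measure_ne_top P _), ← ENNReal.ofReal_toReal (measure_ne_top Ps _),
      ← ENNReal.ofReal_mul (by positivity)]
    congr 1
    simp only [Measure.real] at h
    field_simp at h ⊢
    linarith
  have i : ∀ μ : Measure Ω, ∫ ω in {ω | D ω = d}, g (Y ω, Z ω) ∂μ =
      ∫ q, g q ∂((μ.restrict {ω | D ω = d}).map (fun ω => (Y ω, Z ω))) := fun μ =>
    (integral_map hYZ.aemeasurable hg.aestronglyMeasurable).symm
  rw [i, i, key, integral_smul_measure, ENNReal.toReal_ofReal (by positivity), smul_eq_mul]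

/-- **Proposition 5.** Under the stratification assumption, for every measurable
`φ : ℝ × {0,1} × {0,1} → ℝ` such that `φ(Y,Z,D)` is `P`-integrable and `W·φ(Y,Z,D)` is
`P*`-integrable, one has `E_P[φ(Y,Z,D)] = E_{P*}[W·φ(Y,Z,D)]`, where
`W = D·(π/π*) + (1−D)·((1−π)/(1−π*))`. -/
theorem stmt_0 {Ω : Type*} [MeasurableSpace Ω]
    (P Pstar : Measure Ω) [IsProbabilityMeasure P] [IsProbabilityMeasure Pstar]
    (D Y Z : Ω → ℝ) (hD : Measurable D) (hY : Measurable Y) (hZ : Measurable Z)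
    (hDval : ∀ ω, D ω = 0 ∨ D ω = 1) (hZval : ∀ ω, Z ω = 0 ∨ Z ω = 1)
    (π πs : ℝ) (hπdef : π = (P {ω | D ω = 1}).toReal) (hπsdef : πs = (Pstar {ω | D ω = 1}).toReal)
    (hπ0 : 0 < π) (hπ1 : π < 1) (hπs0 : 0 < πs) (hπs1 : πs < 1)
    -- stratification: random sampling within each treatment stratum
    (hstrat : ∀ d ∈ ({0, 1} : Set ℝ), ∀ f : ℝ × ℝ → ℝ, Measurable f → (∃ C, ∀ p, |f p| ≤ C) →
      (∫ ω, (if D ω = d then (1 : ℝ) else 0) * f (Y ω, Z ω) ∂P) / (P {ω | D ω = d}).toReal =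
        (∫ ω, (if D ω = d then (1 : ℝ) else 0) * f (Y ω, Z ω) ∂Pstar) /
          (Pstar {ω | D ω = d}).toReal) :
    ∀ φ : ℝ × ℝ × ℝ → ℝ, Measurable φ →
      Integrable (fun ω => φ (Y ω, Z ω, D ω)) P →
      Integrable (fun ω => (D ω * (π / πs) + (1 - D ω) * ((1 - π) / (1 - πs))) *
        φ (Y ω, Z ω, D ω)) Pstar →
      ∫ ω, φ (Y ω, Z ω, D ω) ∂P =
        ∫ ω, (D ω * (π / πs) + (1 - D ω) * ((1 - π) / (1 - πs))) * φ (Y ω, Z ω, D ω) ∂Pstar := by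
  intro φ hφ h1 h2
  have hS : MeasurableSet {ω | D ω = 1} := hD (measurableSet_singleton 1)
  have hS0 : MeasurableSet {ω | D ω = 0} := hD (measurableSet_singleton 0)
  have hc : {ω | D ω = 1}ᶜ = {ω | D ω = 0} := by
    ext ω
    rcases hDval ω with h | h <;> simp [h]
  have q0 : (P {ω | D ω = 0}).toReal = 1 - π := by
    rw [hπdef, ← hc]; exact probReal_compl_eq_one_sub hS
  have qs0 : (Pstar {ω | D ω = 0}).toReal = 1 - πs := by
    rw [hπsdef, ← hc]; exact probReal_compl_eq_one_sub hS
  have s1 := hstrat 1 (by simp)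
  have s0 := hstrat 0 (by simp)
  rw [← hπdef, ← hπsdef] at s1
  rw [q0, qs0] at s0
  have a1 := aux_strat P Pstar D Y Z hD hY hZ 1 π πs hπ0 hπs0 s1 (fun q => φ (q.1, q.2, 1))
    (by fun_prop)
  have a0 := aux_strat P Pstar D Y Z hD hY hZ 0 (1 - π) (1 - πs) (by linarith) (by linarith) s0
    (fun q => φ (q.1, q.2, 0)) (by fun_prop)
  rw [← integral_add_compl hS h1, ← integral_add_compl hS h2, hc]
  congr 1
  · rw [setIntegral_congr_fun (g := fun ω => φ (Y ω, Z ω, 1)) hS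
        (fun ω (h : D ω = 1) => by simp [h]), a1, ← integral_const_mul]
    exact setIntegral_congr_fun hS (fun ω (h : D ω = 1) => by simp [h])
  · rw [setIntegral_congr_fun (g := fun ω => φ (Y ω, Z ω, 0)) hS0
        (fun ω (h : D ω = 0) => by simp [h]), a0, ← integral_const_mul]
    exact setIntegral_congr_fun hS0 (fun ω (h : D ω = 0) => by simp [h])
end

section
/- Under the stratification assumption, for all real numbers α and β such that Y − α − βD is P-integrable and W·(Y − α − βD) is P*-integrable, one has E_P[Y − α − βD] = E_{P*}[W·(Y − α − βD)] and E_P[Z·(Y − α − βD)] = E_{P*}[W·Z·(Y − α − βD)]. Consequently a pair (α, β) satisfies the population instrumental-variable moment conditions E_P[Y − α − βD] = 0 and E_P[Z(Y − α − βD)] = 0 if and only if it satisfies the reweighted sample moment conditions E_{P*}[W(Y − α − βD)] = 0 and E_{P*}[W·Z·(Y − α − βD)] = 0. -/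
open MeasureTheory

theorem aux_stratum {Ω : Type*} [MeasurableSpace Ω]
    (P Q : Measure Ω) [IsProbabilityMeasure P] [IsProbabilityMeasure Q]
    (D Y Z : Ω → ℝ) (hD : Measurable D) (hY : Measurable Y) (hZ : Measurable Z)
    (d p q : ℝ) (hp : (P {ω | D ω = d}).toReal = p) (hq : (Q {ω | D ω = d}).toReal = q)
    (hp0 : 0 < p) (hq0 : 0 < q)
    (hs : ∀ f : ℝ × ℝ → ℝ, Measurable f → (∃ C, ∀ p, |f p| ≤ C) →
      (∫ ω, (if D ω = d then (1 : ℝ) else 0) * f (Y ω, Z ω) ∂P) / (P {ω | D ω = d}).toReal =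
        (∫ ω, (if D ω = d then (1 : ℝ) else 0) * f (Y ω, Z ω) ∂Q) /
          (Q {ω | D ω = d}).toReal)
    (g : ℝ × ℝ → ℝ) (hg : Measurable g) :
    ∫ ω in {ω | D ω = d}, g (Y ω, Z ω) ∂P = (p / q) * ∫ ω in {ω | D ω = d}, g (Y ω, Z ω) ∂Q := by
  have hYZ : Measurable (fun ω => (Y ω, Z ω)) := hY.prodMk hZ
  have hA : MeasurableSet {ω | D ω = d} := hD (measurableSet_singleton d)
  have key : ∀ (μ : Measure Ω) [IsProbabilityMeasure μ] (s : Set (ℝ × ℝ)), MeasurableSet s →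
      ∫ ω, (if D ω = d then (1 : ℝ) else 0) * s.indicator (fun _ => (1 : ℝ)) (Y ω, Z ω) ∂μ
        = ((μ.restrict {ω | D ω = d}).map (fun ω => (Y ω, Z ω))).real s := by
    intro μ _ s hsm
    rw [map_measureReal_apply hYZ hsm, measureReal_restrict_apply (hYZ hsm),
      ← integral_indicator_one ((hYZ hsm).inter hA)]
    congr 1
    funext ω
    by_cases h1 : D ω = d <;> by_cases h2 : (Y ω, Z ω) ∈ s <;>
      simp [Set.indicator, h1, h2]
  have hm : (P.restrict {ω | D ω = d}).map (fun ω => (Y ω, Z ω))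
      = ENNReal.ofReal (p / q) • (Q.restrict {ω | D ω = d}).map (fun ω => (Y ω, Z ω)) := by
    ext s hsm
    have h := hs (s.indicator (fun _ => (1 : ℝ))) (measurable_const.indicator hsm)
      ⟨1, fun x => by by_cases hx : x ∈ s <;> simp [hx]⟩
    rw [key P s hsm, key Q s hsm, hp, hq] at h
    have h' : ((P.restrict {ω | D ω = d}).map (fun ω => (Y ω, Z ω))).real s
        = (p / q) * ((Q.restrict {ω | D ω = d}).map (fun ω => (Y ω, Z ω))).real s := by
      field_simp at h ⊢
      linarith
    rw [Measure.smul_apply, smul_eq_mul, ← ofReal_measureReal, ← ofReal_measureReal, h',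
      ENNReal.ofReal_mul (by positivity)]
  have e1 := integral_map (μ := P.restrict {ω | D ω = d}) hYZ.aemeasurable
    (f := g) hg.aestronglyMeasurable
  have e2 := integral_map (μ := Q.restrict {ω | D ω = d}) hYZ.aemeasurable
    (f := g) hg.aestronglyMeasurable
  rw [← e1, ← e2, hm, integral_smul_measure, ENNReal.toReal_ofReal (by positivity), smul_eq_mul]

/-- Under the stratification assumption, the population instrumental-variable
moments of `Y − α − βD` equal the reweighted sample moments, and consequently `(α, β)` solves
the population IV moment conditions iff it solves the reweighted sample moment conditions.
Hence the population Wald ratio (the LATE) is identified by reweighting. -/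
theorem stmt_1 {Ω : Type*} [MeasurableSpace Ω]
    (P Pstar : Measure Ω) [IsProbabilityMeasure P] [IsProbabilityMeasure Pstar]
    (D Y Z : Ω → ℝ) (hD : Measurable D) (hY : Measurable Y) (hZ : Measurable Z)
    (hDval : ∀ ω, D ω = 0 ∨ D ω = 1) (hZval : ∀ ω, Z ω = 0 ∨ Z ω = 1)
    (π πs : ℝ) (hπdef : π = (P {ω | D ω = 1}).toReal) (hπsdef : πs = (Pstar {ω | D ω = 1}).toReal)
    (hπ0 : 0 < π) (hπ1 : π < 1) (hπs0 : 0 < πs) (hπs1 : πs < 1)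
    -- stratification: random sampling within each treatment stratum
    (hstrat : ∀ d ∈ ({0, 1} : Set ℝ), ∀ f : ℝ × ℝ → ℝ, Measurable f → (∃ C, ∀ p, |f p| ≤ C) →
      (∫ ω, (if D ω = d then (1 : ℝ) else 0) * f (Y ω, Z ω) ∂P) / (P {ω | D ω = d}).toReal =
        (∫ ω, (if D ω = d then (1 : ℝ) else 0) * f (Y ω, Z ω) ∂Pstar) /
          (Pstar {ω | D ω = d}).toReal)
    (α β : ℝ)
    (hint : Integrable (fun ω => Y ω - α - β * D ω) P)
    (hintW : Integrable (fun ω => (D ω * (π / πs) + (1 - D ω) * ((1 - π) / (1 - πs))) *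
      (Y ω - α - β * D ω)) Pstar) :
    (∫ ω, (Y ω - α - β * D ω) ∂P =
        ∫ ω, (D ω * (π / πs) + (1 - D ω) * ((1 - π) / (1 - πs))) * (Y ω - α - β * D ω) ∂Pstar) ∧
    (∫ ω, Z ω * (Y ω - α - β * D ω) ∂P =
        ∫ ω, (D ω * (π / πs) + (1 - D ω) * ((1 - π) / (1 - πs))) * (Z ω * (Y ω - α - β * D ω))
          ∂Pstar) ∧
    ((∫ ω, (Y ω - α - β * D ω) ∂P = 0 ∧ ∫ ω, Z ω * (Y ω - α - β * D ω) ∂P = 0) ↔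
      ((∫ ω, (D ω * (π / πs) + (1 - D ω) * ((1 - π) / (1 - πs))) * (Y ω - α - β * D ω) ∂Pstar = 0)
        ∧ (∫ ω, (D ω * (π / πs) + (1 - D ω) * ((1 - π) / (1 - πs))) *
            (Z ω * (Y ω - α - β * D ω)) ∂Pstar = 0))) := by
  have hA1 : MeasurableSet {ω | D ω = 1} := hD (measurableSet_singleton 1)
  have hcompl : {ω | D ω = 1}ᶜ = {ω | D ω = 0} := by
    ext ω
    rcases hDval ω with h | h <;> simp [h]
  have hA0 : MeasurableSet {ω | D ω = 0} := hD (measurableSet_singleton 0)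
  have c0 : ∀ (μ : Measure Ω) [IsProbabilityMeasure μ],
      (μ {ω | D ω = 0}).toReal = 1 - (μ {ω | D ω = 1}).toReal := by
    intro μ _
    rw [← hcompl]
    exact probReal_compl_eq_one_sub hA1
  have main : ∀ k : ℝ × ℝ → ℝ, Measurable k →
      Integrable (fun ω => k (Y ω, Z ω) * (Y ω - α - β * D ω)) P →
      Integrable (fun ω => (D ω * (π / πs) + (1 - D ω) * ((1 - π) / (1 - πs))) *
        (k (Y ω, Z ω) * (Y ω - α - β * D ω))) Pstar →
      ∫ ω, k (Y ω, Z ω) * (Y ω - α - β * D ω) ∂P =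
        ∫ ω, (D ω * (π / πs) + (1 - D ω) * ((1 - π) / (1 - πs))) *
          (k (Y ω, Z ω) * (Y ω - α - β * D ω)) ∂Pstar := by
    intro k hk h1 h2
    rw [← integral_add_compl hA1 h1, ← integral_add_compl hA1 h2, hcompl]
    have s1 := aux_stratum P Pstar D Y Z hD hY hZ 1 π πs hπdef.symm hπsdef.symm hπ0 hπs0
      (hstrat 1 (by simp)) (fun x => k x * (x.1 - α - β * 1)) (by fun_prop)
    have s0 := aux_stratum P Pstar D Y Z hD hY hZ 0 (1 - π) (1 - πs)
      (by rw [c0, hπdef]) (by rw [c0, hπsdef]) (by linarith) (by linarith)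
      (hstrat 0 (by simp)) (fun x => k x * (x.1 - α - β * 0)) (by fun_prop)
    rw [← integral_const_mul] at s1 s0
    congr 1
    · refine Eq.trans (setIntegral_congr_fun hA1 ?_) (s1.trans (setIntegral_congr_fun hA1 ?_)) <;>
      · intro ω hω
        have hω' : D ω = 1 := hω
        simp [hω']
    · refine Eq.trans (setIntegral_congr_fun hA0 ?_) (s0.trans (setIntegral_congr_fun hA0 ?_)) <;>
      · intro ω hω
        have hω' : D ω = 0 := hω
        simp [hω']
  have m1 := main (fun _ => 1) measurable_const (by simpa using hint) (by simpa using hintW)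
  have hZb : ∀ ω, ‖Z ω‖ ≤ 1 := fun ω => by rcases hZval ω with h | h <;> simp [h]
  have m2 := main (fun x => x.2) measurable_snd
    (hint.bdd_mul hZ.aestronglyMeasurable (Filter.Eventually.of_forall hZb))
    (by
      refine (hintW.bdd_mul hZ.aestronglyMeasurable (Filter.Eventually.of_forall hZb)).congr
        (Filter.Eventually.of_forall fun ω => ?_)
      simp only []
      ring)
  simp only [one_mul] at m1
  simp only [] at m2
  refine ⟨m1, m2, ?_⟩
  rw [m1, m2]
end

section
/- Under the stratification assumption and unconfoundedness with overlap under P, if β*₁ and β*₀ are versions of E_{P*}[Y|D=1,X] and E_{P*}[Y|D=0,X] with β*₁(X), β*₀(X) integrable under both P and P*, then the average treatment effect satisfies E_P[Y₁ − Y₀] = E_{P*}[W · (β*₁(X) − β*₀(X))]. -/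
open MeasureTheory ProbabilityTheory


lemma aux_ci {Ω : Type*} {m mΩ : MeasurableSpace Ω} (hm : m ≤ mΩ) (P : Measure Ω)
    [IsProbabilityMeasure P] (Z : Ω → ℝ) (hZ : Measurable Z)
    (S : Set Ω) (hS : MeasurableSet S)
    (h : ∀ B, MeasurableSet B → (P⟦Z ⁻¹' B ∩ S | m⟧) =ᵐ[P]
      fun ω => (P⟦Z ⁻¹' B | m⟧) ω * (P⟦S | m⟧) ω)
    (hpos : ∀ᵐ ω ∂P, 0 < (P⟦S | m⟧) ω)
    (A : Set Ω) (hA : MeasurableSet[m] A) :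
    ∫ ω in A ∩ S, Z ω ∂P = ∫ ω in A, (P⟦S | m⟧) ω * Z ω ∂P := by
  have hem : StronglyMeasurable[m] (P⟦S | m⟧) := stronglyMeasurable_condExp
  have hei : Integrable (P⟦S | m⟧) P := integrable_condExp
  have hA' := hm A hA
  have hmeas : Measurable (fun ω => ENNReal.ofReal ((P⟦S | m⟧) ω)) :=
    ENNReal.measurable_ofReal.comp (hem.mono hm).measurable
  have key : (P.restrict (A ∩ S)).map Z =
      ((P.restrict A).withDensity (fun ω => ENNReal.ofReal ((P⟦S | m⟧) ω))).map Z := by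
    ext B hB
    have hB' : MeasurableSet (Z ⁻¹' B) := hZ hB
    rw [Measure.map_apply hZ hB, Measure.map_apply hZ hB, Measure.restrict_apply hB',
      withDensity_apply _ hB', Measure.restrict_restrict hB',
      ← ofReal_integral_eq_lintegral_ofReal hei.integrableOn
        (ae_restrict_of_ae (hpos.mono fun ω h => h.le)), ← ofReal_measureReal]
    congr 1
    have hind : Integrable ((Z ⁻¹' B).indicator fun _ => (1 : ℝ)) P :=
      (integrable_const 1).indicator hB'
    have hprod : ((Z ⁻¹' B).indicator fun _ => (1 : ℝ)) * (P⟦S | m⟧)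
        = (Z ⁻¹' B).indicator (P⟦S | m⟧) := by
      ext ω; by_cases hω : ω ∈ Z ⁻¹' B <;> simp [hω]
    have hpi : Integrable (((Z ⁻¹' B).indicator fun _ => (1 : ℝ)) * (P⟦S | m⟧)) P := by
      rw [hprod]; exact hei.indicator hB'
    have h1 := condExp_mul_of_stronglyMeasurable_right hem hpi hind
    calc P.real (Z ⁻¹' B ∩ (A ∩ S))
        = ∫ ω in A, (Z ⁻¹' B ∩ S).indicator (fun _ => (1 : ℝ)) ω ∂P := by
          rw [setIntegral_indicator (hB'.inter hS)]
          simp only [integral_const, smul_eq_mul, mul_one, measureReal_restrict_apply_univ]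
          congr 1; ext ω; simp; tauto
      _ = ∫ ω in A, (P⟦Z ⁻¹' B ∩ S | m⟧) ω ∂P :=
          (setIntegral_condExp hm ((integrable_const 1).indicator (hB'.inter hS)) hA).symm
      _ = ∫ ω in A, (P[((Z ⁻¹' B).indicator fun _ => (1 : ℝ)) * (P⟦S | m⟧) | m]) ω ∂P := by
          apply integral_congr_ae
          apply ae_restrict_of_ae
          filter_upwards [h B hB, h1] with ω h2 h3
          rw [h2, h3]; rfl
      _ = ∫ ω in A, (Z ⁻¹' B).indicator (P⟦S | m⟧) ω ∂P := by
          rw [setIntegral_condExp hm hpi hA, hprod]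
      _ = _ := by
          rw [setIntegral_indicator hB', Set.inter_comm]
  have e1 := integral_map (μ := P.restrict (A ∩ S)) hZ.aemeasurable
    (f := fun x : ℝ => x) measurable_id.aestronglyMeasurable
  have e2 := integral_map
    (μ := (P.restrict A).withDensity (fun ω => ENNReal.ofReal ((P⟦S | m⟧) ω))) hZ.aemeasurable
    (f := fun x : ℝ => x) measurable_id.aestronglyMeasurable
  rw [← e1, key, e2, integral_withDensity_eq_integral_toReal_smul hmeas (by simp)]
  apply integral_congr_ae
  apply ae_restrict_of_ae
  filter_upwards [hpos] with ω hω
  simp [ENNReal.toReal_ofReal hω.le]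

lemma aux_id {Ω : Type*} {m mΩ : MeasurableSpace Ω} (hm : m ≤ mΩ) (P : Measure Ω)
    [IsProbabilityMeasure P] (Z : Ω → ℝ) (hZ : Measurable Z) (hZi : Integrable Z P)
    (S : Set Ω) (hS : MeasurableSet S)
    (h : ∀ B, MeasurableSet B → (P⟦Z ⁻¹' B ∩ S | m⟧) =ᵐ[P]
      fun ω => (P⟦Z ⁻¹' B | m⟧) ω * (P⟦S | m⟧) ω)
    (hpos : ∀ᵐ ω ∂P, 0 < (P⟦S | m⟧) ω)
    (b : Ω → ℝ) (hb : StronglyMeasurable[m] b) (hbi : Integrable b P)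
    (hA : ∀ A, MeasurableSet[m] A → ∫ ω in A ∩ S, Z ω ∂P = ∫ ω in A ∩ S, b ω ∂P) :
    ∫ ω, Z ω ∂P = ∫ ω, b ω ∂P := by
  have hem : StronglyMeasurable[m] (P⟦S | m⟧) := stronglyMeasurable_condExp
  have hei : Integrable (P⟦S | m⟧) P := integrable_condExp
  have hbd : ∀ᵐ ω ∂P, ‖(P⟦S | m⟧) ω‖ ≤ 1 := by
    have := condExp_mono (m := m) (μ := P) (f := S.indicator fun _ => (1 : ℝ))
      (g := fun _ => (1 : ℝ)) ((integrable_const 1).indicator hS) (integrable_const 1)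
      (Filter.Eventually.of_forall fun ω => by by_cases hω : ω ∈ S <;> simp [hω])
    rw [condExp_const hm] at this
    filter_upwards [this, hpos] with ω h1 h2
    rw [Real.norm_eq_abs, abs_of_pos h2]; exact h1
  have heZ : Integrable ((P⟦S | m⟧) * Z) P :=
    hZi.bdd_mul (hem.mono hm).aestronglyMeasurable hbd
  have heb : Integrable ((P⟦S | m⟧) * b) P :=
    hbi.bdd_mul (hem.mono hm).aestronglyMeasurable hbd
  have heZ' : Integrable ((P⟦S | m⟧) * P[Z | m]) P :=
    integrable_condExp.bdd_mul (hem.mono hm).aestronglyMeasurable hbd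
  have p1 := condExp_mul_of_stronglyMeasurable_left hem heZ hZi
  have hprod : (S.indicator fun _ => (1 : ℝ)) * b = S.indicator b := by
    ext ω; by_cases hω : ω ∈ S <;> simp [hω]
  have hpi : Integrable ((S.indicator fun _ => (1 : ℝ)) * b) P := by
    rw [hprod]; exact hbi.indicator hS
  have p2 := condExp_mul_of_stronglyMeasurable_right hb hpi ((integrable_const 1).indicator hS)
  have hae : (P⟦S | m⟧) * P[Z | m] =ᵐ[P] (P⟦S | m⟧) * b := by
    refine ae_eq_of_forall_setIntegral_eq_of_sigmaFinite' hm (fun s _ _ => heZ'.integrableOn)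
      (fun s _ _ => heb.integrableOn) (fun s hs _ => ?_)
      (hem.mul stronglyMeasurable_condExp).aestronglyMeasurable
      (hem.mul hb).aestronglyMeasurable
    rw [← integral_congr_ae (ae_restrict_of_ae p1), ← integral_congr_ae (ae_restrict_of_ae p2),
      setIntegral_condExp hm heZ hs, setIntegral_condExp hm hpi hs, hprod,
      setIntegral_indicator hS, ← hA s hs, aux_ci hm P Z hZ S hS h hpos s hs]
    rfl
  rw [← integral_condExp hm (f := Z)]
  apply integral_congr_ae
  filter_upwards [hae, hpos] with ω h1 h2
  exact mul_left_cancel₀ h2.ne' h1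

lemma aux_map {Ω 𝓧 : Type*} [MeasurableSpace Ω] [MeasurableSpace 𝓧]
    (P Pstar : Measure Ω) [IsProbabilityMeasure P] [IsProbabilityMeasure Pstar]
    (T : Ω → 𝓧) (hT : Measurable T) (S : Set Ω) (hS : MeasurableSet S)
    (hp : P S ≠ 0)
    (hstrat : ∀ f : 𝓧 → ℝ, Measurable f → (∃ C, ∀ p, |f p| ≤ C) →
      (∫ ω in S, f (T ω) ∂P) / (P S).toReal = (∫ ω in S, f (T ω) ∂Pstar) / (Pstar S).toReal) :
    (P.restrict S).map T =
      ENNReal.ofReal ((P S).toReal / (Pstar S).toReal) • (Pstar.restrict S).map T := by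
  ext B hB
  have hB' := hT hB
  have := hstrat (B.indicator fun _ => 1) (measurable_const.indicator hB)
    ⟨1, fun p => by by_cases hω : p ∈ B <;> simp [hω]⟩
  have e : ∀ Q : Measure Ω, ∫ ω in S, B.indicator (fun _ => (1 : ℝ)) (T ω) ∂Q
      = Q.real (S ∩ T ⁻¹' B) := by
    intro Q
    have : ∀ ω, B.indicator (fun _ => (1 : ℝ)) (T ω) = (T ⁻¹' B).indicator (fun _ => 1) ω :=
      fun ω => rfl
    simp_rw [this]
    rw [setIntegral_indicator hB']; simp
  rw [e, e] at this
  have hp' : (P S).toReal ≠ 0 := by simp [ENNReal.toReal_eq_zero_iff, hp]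
  rw [Measure.smul_apply, Measure.map_apply hT hB, Measure.map_apply hT hB,
    Measure.restrict_apply hB', Measure.restrict_apply hB', ← ofReal_measureReal (μ := P) (s := T ⁻¹' B ∩ S),
    ← ofReal_measureReal (μ := Pstar) (s := T ⁻¹' B ∩ S), smul_eq_mul, ← ENNReal.ofReal_mul (by positivity)]
  congr 1
  rw [Set.inter_comm]
  rw [div_eq_iff hp'] at this
  rw [this]; ring

lemma aux_arm {Ω 𝓧 : Type*} [MeasurableSpace Ω] [MeasurableSpace 𝓧]
    (P Pstar : Measure Ω) [IsProbabilityMeasure P] [IsProbabilityMeasure Pstar]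
    (Y : Ω → ℝ) (X : Ω → 𝓧) (hY : Measurable Y) (hX : Measurable X)
    (S : Set Ω) (hS : MeasurableSet S) (c : ℝ) (hc : 0 < c)
    (hmap : (P.restrict S).map (fun ω => (Y ω, X ω)) =
      ENNReal.ofReal c • (Pstar.restrict S).map (fun ω => (Y ω, X ω)))
    (Z : Ω → ℝ) (hZ : Measurable Z) (hZi : Integrable Z P) (hYZ : ∀ ω ∈ S, Y ω = Z ω)
    (h : ∀ B, MeasurableSet B → (P⟦Z ⁻¹' B ∩ S | MeasurableSpace.comap X inferInstance⟧) =ᵐ[P]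
      fun ω => (P⟦Z ⁻¹' B | MeasurableSpace.comap X inferInstance⟧) ω *
        (P⟦S | MeasurableSpace.comap X inferInstance⟧) ω)
    (hpos : ∀ᵐ ω ∂P, 0 < (P⟦S | MeasurableSpace.comap X inferInstance⟧) ω)
    (β : 𝓧 → ℝ) (hβ : Measurable β) (hβi : Integrable (fun ω => β (X ω)) Pstar)
    (hβiP : Integrable (fun ω => β (X ω)) P)
    (hv : Pstar[S.indicator fun ω => Y ω - β (X ω) | MeasurableSpace.comap X inferInstance]
      =ᵐ[Pstar] 0) :
    ∫ ω, Z ω ∂P = ∫ ω, β (X ω) ∂P := by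
  have hm := hX.comap_le
  have hT : Measurable (fun ω => (Y ω, X ω)) := hY.prodMk hX
  have hYP : IntegrableOn Y S P :=
    (hZi.integrableOn (s := S)).congr_fun (fun ω hω => (hYZ ω hω).symm) hS
  have hYs : IntegrableOn Y S Pstar := by
    have h1 : Integrable (fun p : ℝ × 𝓧 => p.1) ((P.restrict S).map fun ω => (Y ω, X ω)) :=
      (integrable_map_measure measurable_fst.aestronglyMeasurable hT.aemeasurable).2 hYP
    rw [hmap, integrable_smul_measure (by simpa using hc) (by simp)] at h1
    exact (integrable_map_measure measurable_fst.aestronglyMeasurable hT.aemeasurable).1 h1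
  refine aux_id hm P Z hZ hZi S hS h hpos (fun ω => β (X ω))
    (hβ.comp (comap_measurable X)).stronglyMeasurable hβiP ?_
  rintro A ⟨A', hA', rfl⟩
  have hAm : MeasurableSet (X ⁻¹' A') := hX hA'
  have hs : ∫ ω in S, A'.indicator 1 (X ω) * (Y ω - β (X ω)) ∂Pstar = 0 := by
    have hi : Integrable (S.indicator fun ω => Y ω - β (X ω)) Pstar :=
      (integrable_indicator_iff hS).2 (hYs.sub hβi.integrableOn)
    have h1 := setIntegral_condExp hm hi (s := X ⁻¹' A') ⟨A', hA', rfl⟩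
    rw [integral_congr_ae (ae_restrict_of_ae hv)] at h1
    rw [setIntegral_indicator hS, Set.inter_comm, ← setIntegral_indicator hAm] at h1
    simp only [Pi.zero_apply, integral_zero] at h1
    rw [h1]
    congr 1; ext ω
    by_cases hω : X ω ∈ A' <;> simp [hω]
  have hg : Measurable (fun p : ℝ × 𝓧 => A'.indicator (1 : 𝓧 → ℝ) p.2 * (p.1 - β p.2)) :=
    ((measurable_one.indicator hA').comp measurable_snd).mul
      (measurable_fst.sub (hβ.comp measurable_snd))
  have e1 := integral_map (μ := P.restrict S) hT.aemeasurable hg.aestronglyMeasurable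
  have e2 := integral_map (μ := Pstar.restrict S) hT.aemeasurable hg.aestronglyMeasurable
  rw [hmap, integral_smul_measure, e2] at e1
  simp only [] at e1
  rw [hs, smul_zero] at e1
  have e3 : ∫ ω in X ⁻¹' A' ∩ S, (Y ω - β (X ω)) ∂P = 0 := by
    rw [Set.inter_comm, ← setIntegral_indicator hAm, e1]
    congr 1; ext ω
    by_cases hω : X ω ∈ A' <;> simp [hω]
  rw [integral_sub (hYP.mono_set Set.inter_subset_right) hβiP.integrableOn, sub_eq_zero] at e3
  rw [← e3]
  exact setIntegral_congr_fun (hAm.inter hS) fun ω hω => (hYZ ω hω.2).symm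

/-- Under stratification on treatment status and unconfoundedness with overlap
under the population distribution `P`, the ATE is identified by reweighting the sample
conditional treatment effect: `E_P[Y₁ − Y₀] = E_{P*}[W·(β*₁(X) − β*₀(X))]`, where `β*_d` is a
version of `E_{P*}[Y | D = d, X]` and `W = D·(π/π*) + (1−D)·((1−π)/(1−π*))`. -/
theorem stmt_2 {Ω 𝓧 : Type*} [MeasurableSpace Ω] [StandardBorelSpace Ω] [MeasurableSpace 𝓧]
    (P Pstar : Measure Ω) [IsProbabilityMeasure P] [IsProbabilityMeasure Pstar]
    (D Y : Ω → ℝ) (X : Ω → 𝓧) (hD : Measurable D) (hY : Measurable Y) (hX : Measurable X)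
    (hDval : ∀ ω, D ω = 0 ∨ D ω = 1)
    (π πs : ℝ) (hπdef : π = (P {ω | D ω = 1}).toReal) (hπsdef : πs = (Pstar {ω | D ω = 1}).toReal)
    (hπ0 : 0 < π) (hπ1 : π < 1) (hπs0 : 0 < πs) (hπs1 : πs < 1)
    -- stratification: random sampling within each treatment stratum
    (hstrat : ∀ d ∈ ({0, 1} : Set ℝ), ∀ f : ℝ × 𝓧 → ℝ, Measurable f → (∃ C, ∀ p, |f p| ≤ C) →
      (∫ ω, (if D ω = d then (1 : ℝ) else 0) * f (Y ω, X ω) ∂P) / (P {ω | D ω = d}).toReal =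
        (∫ ω, (if D ω = d then (1 : ℝ) else 0) * f (Y ω, X ω) ∂Pstar) /
          (Pstar {ω | D ω = d}).toReal)
    -- potential outcomes
    (Y0 Y1 : Ω → ℝ) (hY0m : Measurable Y0) (hY1m : Measurable Y1)
    (hY0i : Integrable Y0 P) (hY1i : Integrable Y1 P)
    (hobs : ∀ ω, Y ω = D ω * Y1 ω + (1 - D ω) * Y0 ω)
    -- unconfoundedness: (Y₀, Y₁) ⫫ D | σ(X) under P
    (hunconf : CondIndepFun (MeasurableSpace.comap X inferInstance) hX.comap_le
      (fun ω => (Y0 ω, Y1 ω)) D P)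
    -- overlap: 0 < E_P[D | σ(X)] < 1 P-a.s.
    (hoverlap : ∀ᵐ ω ∂P, 0 < (P[D | MeasurableSpace.comap X inferInstance]) ω ∧
      (P[D | MeasurableSpace.comap X inferInstance]) ω < 1)
    -- β*₁, β*₀ : versions of E_{P*}[Y | D = 1, X] and E_{P*}[Y | D = 0, X]
    (β1 β0 : 𝓧 → ℝ) (hβ1m : Measurable β1) (hβ0m : Measurable β0)
    (hβ1i : Integrable (fun ω => β1 (X ω)) Pstar) (hβ0i : Integrable (fun ω => β0 (X ω)) Pstar)
    (hβ1iP : Integrable (fun ω => β1 (X ω)) P) (hβ0iP : Integrable (fun ω => β0 (X ω)) P)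
    (hβ1v : Pstar[fun ω => (if D ω = 1 then (1 : ℝ) else 0) * (Y ω - β1 (X ω)) |
      MeasurableSpace.comap X inferInstance] =ᵐ[Pstar] 0)
    (hβ0v : Pstar[fun ω => (if D ω = 0 then (1 : ℝ) else 0) * (Y ω - β0 (X ω)) |
      MeasurableSpace.comap X inferInstance] =ᵐ[Pstar] 0) :
    ∫ ω, (Y1 ω - Y0 ω) ∂P =
      ∫ ω, (D ω * (π / πs) + (1 - D ω) * ((1 - π) / (1 - πs))) * (β1 (X ω) - β0 (X ω)) ∂Pstar := by
  have hS : ∀ d, MeasurableSet {ω | D ω = d} := fun d => hD (measurableSet_singleton d)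
  have hmul : ∀ (d : ℝ) (g : Ω → ℝ), (fun ω => (if D ω = d then (1 : ℝ) else 0) * g ω)
      = {ω | D ω = d}.indicator g := by
    intro d g; ext ω; by_cases h : D ω = d <;> simp [h]
  have hcompl : {ω | D ω = 0} = {ω | D ω = 1}ᶜ := by
    ext ω; rcases hDval ω with h | h <;> simp [h]
  have hreal0 : ∀ (Q : Measure Ω) [IsProbabilityMeasure Q],
      (Q {ω | D ω = 0}).toReal = 1 - (Q {ω | D ω = 1}).toReal := by
    intro Q _
    rw [hcompl]; exact probReal_compl_eq_one_sub (hS 1)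
  have hT : Measurable (fun ω => (Y ω, X ω)) := hY.prodMk hX
  have hne : ∀ (Q : Measure Ω) (s : Set Ω), 0 < (Q s).toReal → Q s ≠ 0 := by
    intro Q s h h0; simp [h0] at h
  have hp1 : 0 < (P {ω | D ω = 1}).toReal := hπdef ▸ hπ0
  have hp0 : 0 < (P {ω | D ω = 0}).toReal := by rw [hreal0, ← hπdef]; linarith
  have hmapd : ∀ d ∈ ({0, 1} : Set ℝ), P {ω | D ω = d} ≠ 0 →
      (P.restrict {ω | D ω = d}).map (fun ω => (Y ω, X ω)) =
      ENNReal.ofReal ((P {ω | D ω = d}).toReal / (Pstar {ω | D ω = d}).toReal) •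
        (Pstar.restrict {ω | D ω = d}).map (fun ω => (Y ω, X ω)) := by
    intro d hd hp
    refine aux_map P Pstar _ hT _ (hS d) hp ?_
    intro f hf hb
    have := hstrat d hd f hf hb
    rw [hmul d, integral_indicator (hS d), integral_indicator (hS d)] at this
    exact this
  have hmap1 := hmapd 1 (by simp) (hne _ _ hp1)
  have hmap0 := hmapd 0 (by simp) (hne _ _ hp0)
  rw [← hπdef, ← hπsdef] at hmap1
  rw [hreal0, hreal0, ← hπdef, ← hπsdef] at hmap0
  have hc1 : 0 < π / πs := by positivity
  have hc0 : 0 < (1 - π) / (1 - πs) := div_pos (by linarith) (by linarith)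
  have hDind : D = {ω | D ω = 1}.indicator fun _ => (1 : ℝ) := by
    ext ω; rcases hDval ω with h | h <;> simp [h]
  have hDind0 : ({ω | D ω = 0}.indicator fun _ => (1 : ℝ)) = (fun _ => (1 : ℝ)) - D := by
    ext ω; rcases hDval ω with h | h <;> simp [h]
  have hDi : Integrable D P := by
    rw [hDind]; exact (integrable_const 1).indicator (hS 1)
  have hpos1 : ∀ᵐ ω ∂P, 0 < (P⟦{ω | D ω = 1} | MeasurableSpace.comap X inferInstance⟧) ω := by
    rw [← hDind]; exact hoverlap.mono fun ω h => h.1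
  have hpos0 : ∀ᵐ ω ∂P, 0 < (P⟦{ω | D ω = 0} | MeasurableSpace.comap X inferInstance⟧) ω := by
    rw [hDind0]
    have := condExp_sub (μ := P) (integrable_const (1 : ℝ)) hDi
      (MeasurableSpace.comap X inferInstance)
    filter_upwards [hoverlap, this] with ω h1 h2
    rw [h2, Pi.sub_apply, condExp_const hX.comap_le]
    linarith [h1.2]
  have hci := (condIndepFun_iff_condExp_inter_preimage_eq_mul (hY0m.prodMk hY1m) hD).1 hunconf
  have A1 : ∫ ω, Y1 ω ∂P = ∫ ω, β1 (X ω) ∂P := by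
    refine aux_arm P Pstar Y X hY hX _ (hS 1) _ hc1 hmap1 Y1 hY1m hY1i ?_ ?_ hpos1 β1 hβ1m hβ1i
      hβ1iP ?_
    · intro ω hω
      have : D ω = 1 := hω
      rw [hobs, this]; ring
    · intro B hB
      exact hci (Prod.snd ⁻¹' B) {1} (measurable_snd hB) (measurableSet_singleton _)
    · rw [← hmul]; exact hβ1v
  have A0 : ∫ ω, Y0 ω ∂P = ∫ ω, β0 (X ω) ∂P := by
    refine aux_arm P Pstar Y X hY hX _ (hS 0) _ hc0 hmap0 Y0 hY0m hY0i ?_ ?_ hpos0 β0 hβ0m hβ0i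
      hβ0iP ?_
    · intro ω hω
      have : D ω = 0 := hω
      rw [hobs, this]; ring
    · intro B hB
      exact hci (Prod.fst ⁻¹' B) {0} (measurable_fst hB) (measurableSet_singleton _)
    · rw [← hmul]; exact hβ0v
  have hg : Measurable (fun p : ℝ × 𝓧 => β1 p.2 - β0 p.2) :=
    (hβ1m.comp measurable_snd).sub (hβ0m.comp measurable_snd)
  have tr : ∀ (c : ℝ), 0 < c → ∀ S : Set Ω,
      (P.restrict S).map (fun ω => (Y ω, X ω)) =
        ENNReal.ofReal c • (Pstar.restrict S).map (fun ω => (Y ω, X ω)) →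
      ∫ ω in S, (β1 (X ω) - β0 (X ω)) ∂P = c * ∫ ω in S, (β1 (X ω) - β0 (X ω)) ∂Pstar := by
    intro c hc S hmap
    have e1 := integral_map (μ := P.restrict S) hT.aemeasurable hg.aestronglyMeasurable
    have e2 := integral_map (μ := Pstar.restrict S) hT.aemeasurable hg.aestronglyMeasurable
    rw [hmap, integral_smul_measure, e2, ENNReal.toReal_ofReal hc.le] at e1
    exact e1.symm
  have t1 := tr _ hc1 _ hmap1
  have t0 := tr _ hc0 _ hmap0
  have hβs : Integrable (fun ω => β1 (X ω) - β0 (X ω)) Pstar := hβ1i.sub hβ0i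
  have hβP : Integrable (fun ω => β1 (X ω) - β0 (X ω)) P := hβ1iP.sub hβ0iP
  rw [integral_sub hY1i hY0i, A1, A0, ← integral_sub hβ1iP hβ0iP,
    ← integral_add_compl (hS 1) hβP, ← hcompl]
  have hR : (fun ω => (D ω * (π / πs) + (1 - D ω) * ((1 - π) / (1 - πs))) *
        (β1 (X ω) - β0 (X ω))) =
      fun ω => (π / πs) * {ω | D ω = 1}.indicator (fun ω => β1 (X ω) - β0 (X ω)) ω +
        ((1 - π) / (1 - πs)) * {ω | D ω = 0}.indicator (fun ω => β1 (X ω) - β0 (X ω)) ω := by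
    ext ω; rcases hDval ω with h | h <;> simp [h]
  rw [hR, integral_add ((hβs.indicator (hS 1)).const_mul _) ((hβs.indicator (hS 0)).const_mul _),
    integral_const_mul, integral_const_mul, integral_indicator (hS 1), integral_indicator (hS 0)]
  exact congrArg₂ (· + ·) t1 t0
end

section
/- Under the stratification assumption and unconfoundedness with overlap under P, let π*(X) be a version of E_{P*}[D|σ(X)], and let δ*₁, δ*₀ : [0,1] → ℝ be measurable functions with δ*_d(π*(X)) integrable under both P and P* such that E_{P*}[1{D=d}(Y − δ*_d(π*(X))) | σ(π*(X))] = 0 P*-almost surely for d = 0,1 (i.e., δ*_d is a version of E_{P*}[Y|D=d, π*(X)]). Then the average treatment effect satisfies E_P[Y₁ − Y₀] = E_{P*}[W · (δ*₁(π*(X)) − δ*₀(π*(X)))]. -/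
open MeasureTheory ProbabilityTheory

lemma aux_condExp_mul {Ω : Type*} {m mΩ : MeasurableSpace Ω} [StandardBorelSpace Ω]
    {P : Measure Ω} [IsProbabilityMeasure P] (hm : m ≤ mΩ)
    {U V : Ω → ℝ} (hU : Measurable U) (hV : Measurable V) (hUi : Integrable U P)
    (hVi : Integrable V P) (hUV : Integrable (U * V) P)
    (h : CondIndepFun m hm U V P) :
    P[U * V | m] =ᵐ[P] P[U | m] * P[V | m] := by
  have h1 := (condIndepFun_iff_map_prod_eq_prod_map_map hU hV).1 h
  have h1 := ae_of_ae_trim hm h1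
  filter_upwards [h1, condExp_ae_eq_integral_condExpKernel hm hUi,
    condExp_ae_eq_integral_condExpKernel hm hVi,
    condExp_ae_eq_integral_condExpKernel hm hUV] with ω h1 h2 h3 h4
  rw [Pi.mul_apply, h2, h3, h4]
  have hind : IndepFun U V (condExpKernel P m ω) := by
    rw [indepFun_iff_map_prod_eq_prod_map_map hU.aemeasurable hV.aemeasurable]
    rw [Kernel.map_apply _ (by fun_prop), Kernel.prod_apply, Kernel.map_apply _ hU,
      Kernel.map_apply _ hV] at h1
    exact h1
  exact hind.integral_mul_eq_mul_integral hU.aestronglyMeasurable hV.aestronglyMeasurable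

lemma aux_core {Ω : Type*} {m mΩ : MeasurableSpace Ω} [StandardBorelSpace Ω]
    {P : Measure Ω} [IsProbabilityMeasure P] (hm : m ≤ mΩ)
    {D Z E : Ω → ℝ} (hD : Measurable D) (hD01 : ∀ ω, D ω = 0 ∨ D ω = 1)
    (hZ : Measurable Z) (hZi : Integrable Z P)
    (hE : Measurable[m] E) (φ δ : ℝ → ℝ) (hφ : Measurable φ) (hδ : Measurable δ)
    (hφb : ∃ C, ∀ t, |φ t| ≤ C)
    (hδi : Integrable (fun ω => δ (E ω)) P)
    (hind : CondIndepFun m hm Z D P)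
    (hDφ : P[D | m] =ᵐ[P] fun ω => φ (E ω)) (hpos : ∀ᵐ ω ∂P, 0 < φ (E ω))
    (hA : ∀ B, MeasurableSet B →
      ∫ ω in E ⁻¹' B, D ω * (Z ω - δ (E ω)) ∂P = 0) :
    ∫ ω, Z ω ∂P = ∫ ω, δ (E ω) ∂P := by
  have hEm : Measurable E := hE.mono hm le_rfl
  have hG : MeasurableSpace.comap E inferInstance ≤ m := hE.comap_le
  have hGΩ : MeasurableSpace.comap E inferInstance ≤ mΩ := hG.trans hm
  have hDb : ∀ᵐ ω ∂P, ‖D ω‖ ≤ 1 := ae_of_all _ fun ω => by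
    rcases hD01 ω with h | h <;> simp [h]
  have hDi : Integrable D P := Integrable.of_bound hD.aestronglyMeasurable 1 hDb
  have hZDi : Integrable (Z * D) P := hZi.mul_bdd (c := 1) hD.aestronglyMeasurable hDb
  have hδDi : Integrable ((fun ω => δ (E ω)) * D) P := hδi.mul_bdd (c := 1) hD.aestronglyMeasurable hDb
  have hEG : Measurable[MeasurableSpace.comap E inferInstance] E := comap_measurable E
  obtain ⟨C, hC⟩ := hφb
  -- (A)
  have h0 : (0 : Ω → ℝ) =ᵐ[P] P[Z * D - (fun ω => δ (E ω)) * D |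
      MeasurableSpace.comap E inferInstance] := by
    refine ae_eq_condExp_of_forall_setIntegral_eq hGΩ (hZDi.sub hδDi)
      (fun s _ _ => integrableOn_zero) ?_ aestronglyMeasurable_zero
    rintro s ⟨B, hB, rfl⟩ _
    have := hA B hB
    simp only [Pi.zero_apply, integral_zero]
    rw [← this]
    congr 1
    ext ω
    simp; ring
  have h1 := condExp_sub hZDi hδDi (MeasurableSpace.comap E inferInstance)
  -- first
  have h2 : P[Z * D | MeasurableSpace.comap E inferInstance] =ᵐ[P]
      (fun ω => φ (E ω)) * P[Z | MeasurableSpace.comap E inferInstance] := by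
    have a1 := aux_condExp_mul hm hZ hD hZi hDi hZDi hind
    have a2 : P[Z * D | m] =ᵐ[P] (fun ω => φ (E ω)) * P[Z | m] := by
      filter_upwards [a1, hDφ] with ω h1 h2
      rw [h1, Pi.mul_apply, h2, Pi.mul_apply, mul_comm]
    have a3 := condExp_condExp_of_le (μ := P) (f := Z * D) hG hm
    have a4 := condExp_congr_ae (m := MeasurableSpace.comap E inferInstance) a2
    have a5 := condExp_stronglyMeasurable_mul_of_bound (μ := P) hGΩ (f := fun ω => φ (E ω))
      (g := P[Z | m]) (hφ.comp hEG).stronglyMeasurable integrable_condExp C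
      (ae_of_all _ fun ω => hC _)
    have a6 := condExp_condExp_of_le (μ := P) (f := Z) hG hm
    filter_upwards [a3, a4, a5, a6] with ω h3 h4 h5 h6
    rw [← h3, h4, h5, Pi.mul_apply, h6, Pi.mul_apply]
  have h3 : P[(fun ω => δ (E ω)) * D | MeasurableSpace.comap E inferInstance] =ᵐ[P]
      (fun ω => δ (E ω)) * (fun ω => φ (E ω)) := by
    have a1 := condExp_mul_of_stronglyMeasurable_left (μ := P) (hδ.comp hEG).stronglyMeasurable
      hδDi hDi
    have a3 := condExp_condExp_of_le (μ := P) (f := D) hG hm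
    have a4 := condExp_congr_ae (m := MeasurableSpace.comap E inferInstance) hDφ
    have a5 : P[fun ω => φ (E ω) | MeasurableSpace.comap E inferInstance] = fun ω => φ (E ω) :=
      condExp_of_stronglyMeasurable hGΩ (hφ.comp hEG).stronglyMeasurable
        (Integrable.of_bound (hφ.comp hEm).aestronglyMeasurable C (ae_of_all _ fun ω => hC _))
    rw [a5] at a4
    filter_upwards [a1, a3, a4] with ω h1 h3 h4
    simp only [Pi.mul_apply, Function.comp] at h1 ⊢
    rw [← h4, h3]
    exact h1
  have h4 : P[Z | MeasurableSpace.comap E inferInstance] =ᵐ[P] fun ω => δ (E ω) := by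
    filter_upwards [h0, h1, h2, h3, hpos] with ω h0 h1 h2 h3 hp
    rw [← h0, Pi.sub_apply, h2, h3] at h1
    simp only [Pi.mul_apply, Pi.zero_apply] at h1
    have : φ (E ω) * ((P[Z | MeasurableSpace.comap E inferInstance]) ω - δ (E ω)) = 0 := by
      linarith
    rcases mul_eq_zero.1 this with h | h
    · exact absurd h hp.ne'
    · linarith
  rw [← integral_condExp hGΩ, integral_congr_ae h4]

/-- transfer between the two measures within the stratum with indicator `D`. -/
lemma aux_transfer {Ω 𝓧 : Type*} [MeasurableSpace Ω] [MeasurableSpace 𝓧]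
    {P Q : Measure Ω} [IsProbabilityMeasure P] [IsProbabilityMeasure Q]
    {D : Ω → ℝ} {T : Ω → 𝓧} (hD : Measurable D) (hT : Measurable T)
    (hD01 : ∀ ω, D ω = 0 ∨ D ω = 1) {p q : ℝ} (hp : 0 < p) (hq : 0 < q)
    (h : ∀ f : 𝓧 → ℝ, Measurable f → (∃ C, ∀ x, |f x| ≤ C) →
      (∫ ω, D ω * f (T ω) ∂P) / p = (∫ ω, D ω * f (T ω) ∂Q) / q) (f : 𝓧 → ℝ) (hf : Measurable f) :
    ∫ ω, D ω * f (T ω) ∂P = p / q * ∫ ω, D ω * f (T ω) ∂Q ∧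
    (Integrable (fun ω => D ω * f (T ω)) P → Integrable (fun ω => D ω * f (T ω)) Q) := by
  have hS : MeasurableSet {ω | D ω = 1} := hD (measurableSet_singleton 1)
  have hind : ∀ g : 𝓧 → ℝ, (fun ω => D ω * g (T ω)) =
      Set.indicator {ω | D ω = 1} (fun ω => g (T ω)) := by
    intro g
    ext ω
    rcases hD01 ω with h | h <;> simp [Set.indicator, h]
  have hmap : (P.restrict {ω | D ω = 1}).map T =
      ENNReal.ofReal (p / q) • (Q.restrict {ω | D ω = 1}).map T := by
    ext B hB
    have := h (B.indicator 1) (measurable_one.indicator hB)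
      ⟨1, fun x => by by_cases hx : x ∈ B <;> simp [hx]⟩
    have e : ∀ ν : Measure Ω, ∫ ω, D ω * B.indicator 1 (T ω) ∂ν =
        ((ν.restrict {ω | D ω = 1}).map T).real B := by
      intro ν
      rw [hind, integral_indicator hS, ← integral_indicator_one hB,
        integral_map hT.aemeasurable]
      exact (measurable_one.indicator hB).aestronglyMeasurable
    rw [e, e] at this
    rw [← ENNReal.toReal_eq_toReal_iff' (measure_ne_top _ _)]
    · simp only [Measure.smul_apply, smul_eq_mul, ENNReal.toReal_mul]
      rw [ENNReal.toReal_ofReal (by positivity)]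
      simp only [Measure.real] at this
      field_simp at this ⊢
      linarith
    · simp only [Measure.smul_apply, smul_eq_mul]
      exact ENNReal.mul_ne_top ENNReal.ofReal_ne_top (measure_ne_top _ _)
  have hc : ENNReal.ofReal (p / q) ≠ 0 := by
    simp only [ne_eq, ENNReal.ofReal_eq_zero, not_le]; positivity
  rw [hind, integral_indicator hS, integral_indicator hS, integrable_indicator_iff hS,
    integrable_indicator_iff hS]
  constructor
  · have e : ∀ ν : Measure Ω, ∫ ω in {ω | D ω = 1}, f (T ω) ∂ν =
        ∫ x, f x ∂((ν.restrict {ω | D ω = 1}).map T) := fun ν =>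
      (integral_map hT.aemeasurable hf.aestronglyMeasurable).symm
    rw [e, e, hmap, integral_smul_measure, ENNReal.toReal_ofReal (by positivity), smul_eq_mul]
  · intro hi
    have e : ∀ ν : Measure Ω, IntegrableOn (fun ω => f (T ω)) {ω | D ω = 1} ν ↔
        Integrable f ((ν.restrict {ω | D ω = 1}).map T) := fun ν =>
      (integrable_map_measure hf.aestronglyMeasurable hT.aemeasurable).symm
    rw [e] at hi ⊢
    rw [hmap, integrable_smul_measure hc ENNReal.ofReal_ne_top] at hi
    exact hi

lemma aux_reweight {Ω 𝓧 : Type*} [MeasurableSpace Ω] [MeasurableSpace 𝓧]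
    {P Q : Measure Ω} {D : Ω → ℝ} {X : Ω → 𝓧} (hD : Measurable D)
    (hD01 : ∀ ω, D ω = 0 ∨ D ω = 1) {a b : ℝ}
    (h1 : ∀ g : 𝓧 → ℝ, Measurable g → ∫ ω, D ω * g (X ω) ∂P = a * ∫ ω, D ω * g (X ω) ∂Q)
    (h0 : ∀ g : 𝓧 → ℝ, Measurable g →
      ∫ ω, (1 - D ω) * g (X ω) ∂P = b * ∫ ω, (1 - D ω) * g (X ω) ∂Q)
    (g : 𝓧 → ℝ) (hg : Measurable g) (hgP : Integrable (fun ω => g (X ω)) P)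
    (hgQ : Integrable (fun ω => g (X ω)) Q) :
    ∫ ω, g (X ω) ∂P = ∫ ω, (D ω * a + (1 - D ω) * b) * g (X ω) ∂Q := by
  have i1 : ∀ ν : Measure Ω, Integrable (fun ω => g (X ω)) ν →
      Integrable (fun ω => D ω * g (X ω)) ν := fun ν h =>
    h.bdd_mul (c := 1) hD.aestronglyMeasurable (ae_of_all _ fun ω => by
      rcases hD01 ω with h | h <;> simp [h])
  have i0 : ∀ ν : Measure Ω, Integrable (fun ω => g (X ω)) ν →
      Integrable (fun ω => (1 - D ω) * g (X ω)) ν := fun ν h =>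
    h.bdd_mul (c := 1) (hD.const_sub 1).aestronglyMeasurable (ae_of_all _ fun ω => by
      rcases hD01 ω with h | h <;> simp [h])
  calc ∫ ω, g (X ω) ∂P = ∫ ω, (D ω * g (X ω) + (1 - D ω) * g (X ω)) ∂P := by
        congr 1; ext ω; ring
    _ = a * ∫ ω, D ω * g (X ω) ∂Q + b * ∫ ω, (1 - D ω) * g (X ω) ∂Q := by
        rw [integral_add (i1 P hgP) (i0 P hgP), h1 g hg, h0 g hg]
    _ = ∫ ω, (a * (D ω * g (X ω)) + b * ((1 - D ω) * g (X ω))) ∂Q := by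
        rw [integral_add ((i1 Q hgQ).const_mul a) ((i0 Q hgQ).const_mul b),
          integral_const_mul, integral_const_mul]
    _ = _ := by congr 1; ext ω; ring

lemma aux_propensity {Ω 𝓧 : Type*} [MeasurableSpace Ω] [MeasurableSpace 𝓧]
    {P Q : Measure Ω} [IsProbabilityMeasure P] [IsProbabilityMeasure Q]
    {D : Ω → ℝ} {X : Ω → 𝓧} (hD : Measurable D) (hX : Measurable X)
    (hD01 : ∀ ω, D ω = 0 ∨ D ω = 1) {a b : ℝ} (ha : 0 < a) (hb : 0 < b)
    (h1 : ∀ g : 𝓧 → ℝ, Measurable g → ∫ ω, D ω * g (X ω) ∂P = a * ∫ ω, D ω * g (X ω) ∂Q)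
    (h0 : ∀ g : 𝓧 → ℝ, Measurable g →
      ∫ ω, (1 - D ω) * g (X ω) ∂P = b * ∫ ω, (1 - D ω) * g (X ω) ∂Q)
    (e : 𝓧 → ℝ) (he : Measurable e)
    (hee : Q[D | MeasurableSpace.comap X inferInstance] =ᵐ[Q] fun ω => e (X ω)) :
    ∃ φ : ℝ → ℝ, Measurable φ ∧ (∃ C, ∀ t, |φ t| ≤ C) ∧
      P[D | MeasurableSpace.comap X inferInstance] =ᵐ[P] fun ω => φ (e (X ω)) := by
  set c : ℝ → ℝ := fun t => max 0 (min 1 t) with hc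
  have hcm : Measurable c := by fun_prop
  have hc0 : ∀ t, 0 ≤ c t := fun t => le_max_left _ _
  have hc1 : ∀ t, c t ≤ 1 := fun t => max_le zero_le_one (min_le_left _ _)
  have hden : ∀ t, 0 < a * c t + b * (1 - c t) := fun t => by
    rcases le_or_gt (c t) (1 / 2) with h | h
    · have := hc0 t
      have : 0 < b * (1 - c t) := mul_pos hb (by linarith)
      nlinarith [mul_nonneg ha.le (hc0 t)]
    · have := hc1 t
      have : 0 < a * c t := mul_pos ha (by linarith)
      nlinarith [mul_nonneg hb.le (sub_nonneg.2 (hc1 t))]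
  let φ : ℝ → ℝ := fun t => a * c t / (a * c t + b * (1 - c t))
  have hφm : Measurable φ := by fun_prop
  have hφb : ∀ t, |φ t| ≤ 1 := fun t => by
    have h2 : 0 ≤ a * c t := mul_nonneg ha.le (hc0 t)
    have h3 : 0 ≤ b * (1 - c t) := mul_nonneg hb.le (sub_nonneg.2 (hc1 t))
    rw [abs_of_nonneg (div_nonneg h2 (hden t).le), div_le_one (hden t)]
    linarith
  have hDb : ∀ ω, ‖D ω‖ ≤ 1 := fun ω => by rcases hD01 ω with h | h <;> simp [h]
  have hDi : ∀ ν : Measure Ω, IsProbabilityMeasure ν → Integrable D ν := fun ν _ =>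
    Integrable.of_bound hD.aestronglyMeasurable 1 (ae_of_all _ hDb)
  have hXc : Measurable[MeasurableSpace.comap X inferInstance] X := comap_measurable X
  -- bounds of e
  have he01 : ∀ᵐ ω ∂Q, 0 ≤ e (X ω) ∧ e (X ω) ≤ 1 := by
    have b0 : (0 : Ω → ℝ) ≤ᵐ[Q] Q[D | MeasurableSpace.comap X inferInstance] :=
      condExp_nonneg (ae_of_all _ fun ω => by rcases hD01 ω with h | h <;> simp [h])
    have b1 : Q[D | MeasurableSpace.comap X inferInstance] ≤ᵐ[Q]
        Q[fun _ => (1 : ℝ) | MeasurableSpace.comap X inferInstance] :=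
      condExp_mono (hDi Q inferInstance) (integrable_const 1)
        (ae_of_all _ fun ω => by rcases hD01 ω with h | h <;> simp [h])
    rw [condExp_const hX.comap_le] at b1
    filter_upwards [b0, b1, hee] with ω h0 h1 h2
    rw [h2] at h0 h1
    exact ⟨h0, h1⟩
  have hei : Integrable (fun ω => e (X ω)) Q := integrable_condExp.congr hee
  -- replacing D by e
  have hrep : ∀ k : 𝓧 → ℝ, Measurable k → (∀ x, |k x| ≤ 1) →
      ∫ ω, D ω * k (X ω) ∂Q = ∫ ω, e (X ω) * k (X ω) ∂Q := by
    intro k hk hkb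
    have := condExp_stronglyMeasurable_mul_of_bound (μ := Q) hX.comap_le (f := fun ω => k (X ω))
      (hk.comp hXc).stronglyMeasurable (hDi Q inferInstance) 1 (ae_of_all _ fun ω => hkb _)
    calc ∫ ω, D ω * k (X ω) ∂Q = ∫ ω, ((fun ω => k (X ω)) * D) ω ∂Q := by
          congr 1; ext ω; simp [mul_comm]
      _ = _ := by
          rw [← integral_condExp hX.comap_le]
          apply integral_congr_ae
          filter_upwards [this, hee] with ω h h'
          rw [h, Pi.mul_apply, h', mul_comm]
  refine ⟨φ, hφm, ⟨1, hφb⟩, ?_⟩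
  have hφX : ∀ ν : Measure Ω, IsProbabilityMeasure ν → Integrable (fun ω => φ (e (X ω))) ν :=
    fun ν _ => Integrable.of_bound (hφm.comp (he.comp hX)).aestronglyMeasurable 1
      (ae_of_all _ fun ω => hφb _)
  refine (ae_eq_condExp_of_forall_setIntegral_eq hX.comap_le (hDi P inferInstance)
    (fun s _ _ => (hφX P inferInstance).integrableOn) ?_
    (hφm.comp (he.comp hXc)).stronglyMeasurable.aestronglyMeasurable).symm
  rintro s ⟨B, hB, rfl⟩ _
  have hkm : Measurable (B.indicator fun x => φ (e x)) := (hφm.comp he).indicator hB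
  have hkb : ∀ x, |B.indicator (fun x => φ (e x)) x| ≤ 1 := fun x => by
    by_cases hx : x ∈ B
    · simpa [hx] using hφb _
    · simp [hx]
  have hki : ∀ ν : Measure Ω, IsProbabilityMeasure ν →
      Integrable (fun ω => B.indicator (fun x => φ (e x)) (X ω)) ν := fun ν _ =>
    Integrable.of_bound (hkm.comp hX).aestronglyMeasurable 1 (ae_of_all _ fun ω => hkb _)
  have h1m : Measurable (B.indicator (1 : 𝓧 → ℝ)) := measurable_one.indicator hB
  have h1b : ∀ x, |B.indicator (1 : 𝓧 → ℝ) x| ≤ 1 := fun x => by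
    by_cases hx : x ∈ B <;> simp [hx]
  have hL : ∫ ω in X ⁻¹' B, φ (e (X ω)) ∂P = ∫ ω, B.indicator (fun x => φ (e x)) (X ω) ∂P := by
    rw [← integral_indicator (hX hB)]; rfl
  have hR : ∫ ω in X ⁻¹' B, D ω ∂P = ∫ ω, D ω * B.indicator 1 (X ω) ∂P := by
    rw [← integral_indicator (hX hB)]
    congr 1; ext ω
    by_cases hx : X ω ∈ B <;> simp [Set.indicator, hx]
  rw [hL, hR, h1 _ h1m, hrep _ h1m h1b, aux_reweight hD hD01 h1 h0 _ hkm (hki P inferInstance)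
    (hki Q inferInstance)]
  set k : 𝓧 → ℝ := B.indicator fun x => φ (e x) with hk
  have iD : Integrable (fun ω => D ω * k (X ω)) Q :=
    (hki Q inferInstance).bdd_mul (c := 1) hD.aestronglyMeasurable (ae_of_all _ hDb)
  have ie : Integrable (fun ω => e (X ω) * k (X ω)) Q :=
    hei.mul_bdd (c := 1) (hkm.comp hX).aestronglyMeasurable (ae_of_all _ fun ω => hkb _)
  calc ∫ ω, (D ω * a + (1 - D ω) * b) * k (X ω) ∂Q
      = ∫ ω, ((a - b) * (D ω * k (X ω)) + b * k (X ω)) ∂Q := by congr 1; ext ω; ring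
    _ = ∫ ω, ((a - b) * (e (X ω) * k (X ω)) + b * k (X ω)) ∂Q := by
        rw [integral_add (iD.const_mul _) ((hki Q inferInstance).const_mul b),
          integral_add (ie.const_mul _) ((hki Q inferInstance).const_mul b),
          integral_const_mul, integral_const_mul, integral_const_mul, hrep k hkm hkb]
    _ = ∫ ω, a * (e (X ω) * B.indicator 1 (X ω)) ∂Q := by
        apply integral_congr_ae
        filter_upwards [he01] with ω hω
        by_cases hx : X ω ∈ B
        · have hce : c (e (X ω)) = e (X ω) := by simp [hc, hω.1, hω.2]
          have hd := hden (e (X ω))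
          simp only [hk, hx, Set.indicator_of_mem, φ, Pi.one_apply]
          rw [hce] at hd ⊢
          field_simp
          ring
        · simp [hk, hx]
    _ = _ := integral_const_mul _ _

lemma aux_arm_s3 {Ω 𝓧 : Type*} [MeasurableSpace Ω] [StandardBorelSpace Ω] [MeasurableSpace 𝓧]
    {P Q : Measure Ω} [IsProbabilityMeasure P] [IsProbabilityMeasure Q]
    {D Y Z : Ω → ℝ} {X : Ω → 𝓧} (hD : Measurable D) (hX : Measurable X)
    (hD01 : ∀ ω, D ω = 0 ∨ D ω = 1) {a b : ℝ} (ha : 0 < a) (hb : 0 < b)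
    (h1 : ∀ f : ℝ × 𝓧 → ℝ, Measurable f →
      ∫ ω, D ω * f (Y ω, X ω) ∂P = a * ∫ ω, D ω * f (Y ω, X ω) ∂Q ∧
      (Integrable (fun ω => D ω * f (Y ω, X ω)) P → Integrable (fun ω => D ω * f (Y ω, X ω)) Q))
    (h0 : ∀ f : ℝ × 𝓧 → ℝ, Measurable f →
      ∫ ω, (1 - D ω) * f (Y ω, X ω) ∂P = b * ∫ ω, (1 - D ω) * f (Y ω, X ω) ∂Q)
    (hZ : Measurable Z) (hZi : Integrable Z P) (hYZ : ∀ ω, D ω * Y ω = D ω * Z ω)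
    (hind : CondIndepFun (MeasurableSpace.comap X inferInstance) hX.comap_le Z D P)
    (hpos : ∀ᵐ ω ∂P, 0 < (P[D | MeasurableSpace.comap X inferInstance]) ω)
    (ε : 𝓧 → ℝ) (hε : Measurable ε) (ψ : ℝ → ℝ) (hψ : Measurable ψ)
    (hee : Q[D | MeasurableSpace.comap X inferInstance] =ᵐ[Q] fun ω => ψ (ε (X ω)))
    (δ : ℝ → ℝ) (hδ : Measurable δ) (hδi : Integrable (fun ω => δ (ε (X ω))) P)
    (hδv : Q[fun ω => D ω * (Y ω - δ (ε (X ω))) |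
      MeasurableSpace.comap (fun ω => ε (X ω)) inferInstance] =ᵐ[Q] 0) :
    ∫ ω, Z ω ∂P = ∫ ω, δ (ε (X ω)) ∂P := by
  obtain ⟨φ, hφm, ⟨C, hC⟩, hφ⟩ := aux_propensity hD hX hD01 ha hb
    (fun g hg => (h1 (fun p => g p.2) (hg.comp measurable_snd)).1)
    (fun g hg => h0 (fun p => g p.2) (hg.comp measurable_snd)) (fun x => ψ (ε x))
    (hψ.comp hε) hee
  have hXc : Measurable[MeasurableSpace.comap X inferInstance] X := comap_measurable X
  refine aux_core hX.comap_le hD hD01 hZ hZi (hε.comp hXc) (fun t => φ (ψ t)) δ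
    (hφm.comp hψ) hδ ⟨C, fun t => hC _⟩ hδi hind hφ ?_ ?_
  · filter_upwards [hφ, hpos] with ω h h'
    rw [h] at h'; exact h'
  · intro B hB
    have hDb : ∀ᵐ ω ∂P, ‖D ω‖ ≤ 1 := ae_of_all _ fun ω => by
      rcases hD01 ω with h | h <;> simp [h]
    have hf : Measurable (fun p : ℝ × 𝓧 => p.1 - δ (ε p.2)) := by fun_prop
    have heq : (fun ω => D ω * (Z ω - δ (ε (X ω)))) = fun ω => D ω * (Y ω - δ (ε (X ω))) := by
      ext ω; rw [mul_sub, mul_sub, hYZ]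
    have hiP : Integrable (fun ω => D ω * (Y ω - δ (ε (X ω)))) P := by
      rw [← heq]
      exact (hZi.sub hδi).bdd_mul (c := 1) hD.aestronglyMeasurable hDb
    have hiQ := (h1 _ hf).2 hiP
    have hEm : Measurable (fun ω => ε (X ω)) := hε.comp hX
    have hsm : MeasurableSet ((fun ω => ε (X ω)) ⁻¹' B) := hEm hB
    have key : ∀ ν : Measure Ω, ∫ ω in (fun ω => ε (X ω)) ⁻¹' B, D ω * (Y ω - δ (ε (X ω))) ∂ν =
        ∫ ω, D ω * (fun p : ℝ × 𝓧 => (ε ⁻¹' B).indicator 1 p.2 * (p.1 - δ (ε p.2))) (Y ω, X ω)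
          ∂ν := by
      intro ν
      rw [← integral_indicator hsm]
      congr 1; ext ω
      by_cases hx : ε (X ω) ∈ B <;> simp [Set.indicator, hx]
    have hf2 : Measurable (fun p : ℝ × 𝓧 => (ε ⁻¹' B).indicator 1 p.2 * (p.1 - δ (ε p.2))) :=
      ((measurable_one.indicator (hε hB)).comp measurable_snd).mul hf
    change ∫ ω in (fun ω => ε (X ω)) ⁻¹' B, D ω * (Z ω - δ (ε (X ω))) ∂P = 0
    rw [heq, key, (h1 _ hf2).1, ← key, ← setIntegral_condExp hEm.comap_le hiQ ⟨B, hB, rfl⟩,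
      setIntegral_congr_ae hsm (hδv.mono fun ω h _ => h)]
    simp

/-- Under stratification on treatment status and unconfoundedness with overlap
under `P`, the ATE is identified by reweighting the sample conditional treatment effect given
the sample propensity score: `E_P[Y₁ − Y₀] = E_{P*}[W·(δ*₁(π*(X)) − δ*₀(π*(X)))]`, where
`π*(X)` is a version of `E_{P*}[D | σ(X)]` and `δ*_d` is a version of
`E_{P*}[Y | D = d, π*(X)]`. -/
theorem stmt_3 {Ω 𝓧 : Type*} [MeasurableSpace Ω] [StandardBorelSpace Ω] [MeasurableSpace 𝓧]
    (P Pstar : Measure Ω) [IsProbabilityMeasure P] [IsProbabilityMeasure Pstar]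
    (D Y : Ω → ℝ) (X : Ω → 𝓧) (hD : Measurable D) (hY : Measurable Y) (hX : Measurable X)
    (hDval : ∀ ω, D ω = 0 ∨ D ω = 1)
    (π πs : ℝ) (hπdef : π = (P {ω | D ω = 1}).toReal) (hπsdef : πs = (Pstar {ω | D ω = 1}).toReal)
    (hπ0 : 0 < π) (hπ1 : π < 1) (hπs0 : 0 < πs) (hπs1 : πs < 1)
    -- stratification: random sampling within each treatment stratum
    (hstrat : ∀ d ∈ ({0, 1} : Set ℝ), ∀ f : ℝ × 𝓧 → ℝ, Measurable f → (∃ C, ∀ p, |f p| ≤ C) →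
      (∫ ω, (if D ω = d then (1 : ℝ) else 0) * f (Y ω, X ω) ∂P) / (P {ω | D ω = d}).toReal =
        (∫ ω, (if D ω = d then (1 : ℝ) else 0) * f (Y ω, X ω) ∂Pstar) /
          (Pstar {ω | D ω = d}).toReal)
    -- potential outcomes
    (Y0 Y1 : Ω → ℝ) (hY0m : Measurable Y0) (hY1m : Measurable Y1)
    (hY0i : Integrable Y0 P) (hY1i : Integrable Y1 P)
    (hobs : ∀ ω, Y ω = D ω * Y1 ω + (1 - D ω) * Y0 ω)
    -- unconfoundedness: (Y₀, Y₁) ⫫ D | σ(X) under P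
    (hunconf : CondIndepFun (MeasurableSpace.comap X inferInstance) hX.comap_le
      (fun ω => (Y0 ω, Y1 ω)) D P)
    -- overlap: 0 < E_P[D | σ(X)] < 1 P-a.s.
    (hoverlap : ∀ᵐ ω ∂P, 0 < (P[D | MeasurableSpace.comap X inferInstance]) ω ∧
      (P[D | MeasurableSpace.comap X inferInstance]) ω < 1)
    -- π*(X) : a version of E_{P*}[D | σ(X)]
    (estar : 𝓧 → ℝ) (hestarm : Measurable estar)
    (hestar : Pstar[D | MeasurableSpace.comap X inferInstance] =ᵐ[Pstar] fun ω => estar (X ω))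
    -- δ*₁, δ*₀ : versions of E_{P*}[Y | D = 1, π*(X)] and E_{P*}[Y | D = 0, π*(X)]
    (δ1 δ0 : ℝ → ℝ) (hδ1m : Measurable δ1) (hδ0m : Measurable δ0)
    (hδ1i : Integrable (fun ω => δ1 (estar (X ω))) Pstar)
    (hδ0i : Integrable (fun ω => δ0 (estar (X ω))) Pstar)
    (hδ1iP : Integrable (fun ω => δ1 (estar (X ω))) P)
    (hδ0iP : Integrable (fun ω => δ0 (estar (X ω))) P)
    (hδ1v : Pstar[fun ω => (if D ω = 1 then (1 : ℝ) else 0) * (Y ω - δ1 (estar (X ω))) |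
      MeasurableSpace.comap (fun ω => estar (X ω)) inferInstance] =ᵐ[Pstar] 0)
    (hδ0v : Pstar[fun ω => (if D ω = 0 then (1 : ℝ) else 0) * (Y ω - δ0 (estar (X ω))) |
      MeasurableSpace.comap (fun ω => estar (X ω)) inferInstance] =ᵐ[Pstar] 0) :
    ∫ ω, (Y1 ω - Y0 ω) ∂P =
      ∫ ω, (D ω * (π / πs) + (1 - D ω) * ((1 - π) / (1 - πs))) *
        (δ1 (estar (X ω)) - δ0 (estar (X ω))) ∂Pstar := by
  have hT : Measurable (fun ω => (Y ω, X ω)) := hY.prodMk hX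
  have hS1 : MeasurableSet {ω | D ω = 1} := hD (measurableSet_singleton 1)
  have e1 : ∀ ω, (if D ω = 1 then (1 : ℝ) else 0) = D ω := fun ω => by
    rcases hDval ω with h | h <;> simp [h]
  have e0 : ∀ ω, (if D ω = 0 then (1 : ℝ) else 0) = 1 - D ω := fun ω => by
    rcases hDval ω with h | h <;> simp [h]
  have hcompl : {ω | D ω = 0} = {ω | D ω = 1}ᶜ := by
    ext ω
    rcases hDval ω with h | h <;> simp [h]
  have hp0 : ∀ ν : Measure Ω, IsProbabilityMeasure ν →
      (ν {ω | D ω = 0}).toReal = 1 - (ν {ω | D ω = 1}).toReal := fun ν _ => by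
    rw [hcompl]; exact probReal_compl_eq_one_sub hS1
  have hs1 := hstrat 1 (by simp)
  have hs0 := hstrat 0 (by simp)
  simp only [e1, e0] at hs1 hs0 hδ1v hδ0v
  rw [← hπdef, ← hπsdef] at hs1
  rw [hp0 P inferInstance, hp0 Pstar inferInstance, ← hπdef, ← hπsdef] at hs0
  have hD' : Measurable (fun ω => 1 - D ω) := hD.const_sub 1
  have hD'01 : ∀ ω, 1 - D ω = 0 ∨ 1 - D ω = 1 := fun ω => by
    rcases hDval ω with h | h <;> simp [h]
  have t1 := aux_transfer hD hT hDval hπ0 hπs0 hs1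
  have t0 := aux_transfer hD' hT hD'01 (sub_pos.2 hπ1) (sub_pos.2 hπs1) hs0
  have ha : 0 < π / πs := div_pos hπ0 hπs0
  have hb : 0 < (1 - π) / (1 - πs) := div_pos (sub_pos.2 hπ1) (sub_pos.2 hπs1)
  have hDi : ∀ ν : Measure Ω, IsProbabilityMeasure ν → Integrable D ν := fun ν _ =>
    Integrable.of_bound hD.aestronglyMeasurable 1
      (ae_of_all _ fun ω => by rcases hDval ω with h | h <;> simp [h])
  have hce : ∀ ν : Measure Ω, IsProbabilityMeasure ν →
      ν[fun ω => 1 - D ω | MeasurableSpace.comap X inferInstance] =ᵐ[ν]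
        fun ω => 1 - (ν[D | MeasurableSpace.comap X inferInstance]) ω := fun ν _ => by
    have := condExp_sub (integrable_const (1 : ℝ)) (hDi ν inferInstance)
      (MeasurableSpace.comap X inferInstance)
    rw [condExp_const hX.comap_le] at this
    exact this
  have A1 : ∫ ω, Y1 ω ∂P = ∫ ω, δ1 (estar (X ω)) ∂P := by
    refine aux_arm_s3 hD hX hDval ha hb t1 (fun f hf => (t0 f hf).1) hY1m hY1i ?_ ?_ ?_ estar hestarm
      id measurable_id hestar δ1 hδ1m hδ1iP hδ1v
    · intro ω; rw [hobs]; rcases hDval ω with h | h <;> simp [h]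
    · exact hunconf.comp measurable_snd measurable_id
    · exact hoverlap.mono fun ω h => h.1
  have A0 : ∫ ω, Y0 ω ∂P = ∫ ω, δ0 (estar (X ω)) ∂P := by
    refine aux_arm_s3 hD' hX hD'01 hb ha t0 (fun f hf => ?_) hY0m hY0i ?_ ?_ ?_ estar hestarm
      (fun t => 1 - t) (measurable_id.const_sub 1) ?_ δ0 hδ0m hδ0iP hδ0v
    · simpa using (t1 f hf).1
    · intro ω; rw [hobs]; rcases hDval ω with h | h <;> simp [h]
    · exact hunconf.comp measurable_fst (measurable_id.const_sub 1)
    · filter_upwards [hoverlap, hce P inferInstance] with ω h h'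
      rw [h']; linarith [h.2]
    · filter_upwards [hestar, hce Pstar inferInstance] with ω h h'
      rw [h', h]
  rw [integral_sub hY1i hY0i, A1, A0, ← integral_sub hδ1iP hδ0iP]
  exact aux_reweight hD hDval
    (fun g hg => (t1 (fun p => g p.2) (hg.comp measurable_snd)).1)
    (fun g hg => (t0 (fun p => g p.2) (hg.comp measurable_snd)).1)
    (fun x => δ1 (estar x) - δ0 (estar x))
    ((hδ1m.comp hestarm).sub (hδ0m.comp hestarm)) (hδ1iP.sub hδ0iP) (hδ1i.sub hδ0i)
end

section
/- Under the stratification assumption and unconfoundedness with overlap under P, if β*₁ and β*₀ are versions of E_{P*}[Y|D=1,X] and E_{P*}[Y|D=0,X] with β*₁(X), β*₀(X) integrable under both P and P*, then the average treatment effect on the treated is identified by conventional conditioning despite stratification: E_P[D·(Y₁ − Y₀)]/π = E_{P*}[D·(β*₁(X) − β*₀(X))]/π*, i.e. E_P[Y₁ − Y₀ | D=1] = E_{P*}[β*₁(X) − β*₀(X) | D=1]. -/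
open MeasureTheory ProbabilityTheory

theorem aux_condExp_mul_s5 {Ω : Type*} {m : MeasurableSpace Ω} [mΩ : MeasurableSpace Ω]
    [StandardBorelSpace Ω] {μ : Measure Ω} [IsProbabilityMeasure μ] (hm : m ≤ mΩ)
    {f g : Ω → ℝ} (hf : Measurable f) (hg : Measurable g)
    (hfi : Integrable f μ) (hgi : Integrable g μ) (hfgi : Integrable (fun ω => f ω * g ω) μ)
    (h : CondIndepFun m hm f g μ) :
    μ[fun ω => f ω * g ω | m] =ᵐ[μ] fun ω => (μ[f | m]) ω * (μ[g | m]) ω := by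
  have h1 := ae_of_ae_trim hm ((condIndepFun_iff_map_prod_eq_prod_map_map hf hg).1 h)
  filter_upwards [h1, condExp_ae_eq_integral_condExpKernel hm hfi,
    condExp_ae_eq_integral_condExpKernel hm hgi,
    condExp_ae_eq_integral_condExpKernel hm hfgi] with ω h1 h2 h3 h4
  rw [h2, h3, h4]
  rw [Kernel.map_apply _ (hf.prodMk hg), Kernel.prod_apply, Kernel.map_apply _ hf,
    Kernel.map_apply _ hg] at h1
  have e1 : ∫ y, f y * g y ∂condExpKernel μ m ω
      = ∫ p : ℝ × ℝ, p.1 * p.2 ∂((condExpKernel μ m ω).map (fun ω => (f ω, g ω))) := by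
    rw [integral_map (hf.prodMk hg).aemeasurable (by fun_prop)]
  rw [e1, h1, integral_prod_mul (fun x : ℝ => x) (fun x : ℝ => x),
    integral_map hf.aemeasurable (by fun_prop), integral_map hg.aemeasurable (by fun_prop)]

theorem aux_transfer_s5 {Ω E : Type*} [MeasurableSpace Ω] [MeasurableSpace E]
    (P Q : Measure Ω) [IsProbabilityMeasure P] [IsProbabilityMeasure Q]
    (Z : Ω → E) (hZ : Measurable Z) (S : Set Ω) (hS : MeasurableSet S)
    (h : ∀ f : E → ℝ, Measurable f → (∃ C, ∀ p, |f p| ≤ C) →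
      (∫ ω in S, f (Z ω) ∂P) / (P S).toReal = (∫ ω in S, f (Z ω) ∂Q) / (Q S).toReal)
    (hP : P S ≠ 0) (hQ : Q S ≠ 0) :
    (P[|S]).map Z = (Q[|S]).map Z := by
  ext A hA
  have := h (A.indicator 1) (measurable_one.indicator hA)
    ⟨1, fun p => by by_cases hp : p ∈ A <;> simp [hp]⟩
  have key : ∀ μ : Measure Ω, (∫ ω in S, (A.indicator (1 : E → ℝ)) (Z ω) ∂μ)
      = (μ (S ∩ Z ⁻¹' A)).toReal := by
    intro μ
    have : (fun ω => (A.indicator (1 : E → ℝ)) (Z ω)) = (Z ⁻¹' A).indicator 1 := by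
      ext ω; simp [Set.indicator, Set.mem_preimage]; rfl
    rw [this, integral_indicator_one (hZ hA), measureReal_def, Measure.restrict_apply (hZ hA),
      Set.inter_comm]
  rw [key, key] at this
  rw [Measure.map_apply hZ hA, Measure.map_apply hZ hA, cond_apply hS, cond_apply hS]
  rw [← ENNReal.toReal_eq_toReal_iff' (by finiteness) (by finiteness)]
  simp only [ENNReal.toReal_mul, ENNReal.toReal_inv]
  rw [div_eq_inv_mul, div_eq_inv_mul] at this
  exact this

theorem aux_int_cond {Ω : Type*} [MeasurableSpace Ω] (P : Measure Ω) (S : Set Ω) (f : Ω → ℝ) :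
    ∫ ω, f ω ∂P[|S] = (∫ ω in S, f ω ∂P) / (P S).toReal := by
  rw [ProbabilityTheory.cond, integral_smul_measure, ENNReal.toReal_inv, smul_eq_mul, div_eq_inv_mul]

theorem aux_integrable_cond {Ω : Type*} [MeasurableSpace Ω] (P : Measure Ω)
    [IsProbabilityMeasure P] (S : Set Ω) (hP : P S ≠ 0) (f : Ω → ℝ) :
    Integrable f P[|S] ↔ IntegrableOn f S P := by
  rw [ProbabilityTheory.cond, integrable_smul_measure (by simp) (by simpa using hP)]; rfl

/-- Under stratification on treatment status and unconfoundedness with overlap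
under `P`, the ATT is identified by conventional conditioning despite stratification:
`E_P[D·(Y₁ − Y₀)]/π = E_{P*}[D·(β*₁(X) − β*₀(X))]/π*`, i.e.
`E_P[Y₁ − Y₀ | D=1] = E_{P*}[β*₁(X) − β*₀(X) | D=1]`. -/
theorem stmt_5 {Ω 𝓧 : Type*} [MeasurableSpace Ω] [StandardBorelSpace Ω] [MeasurableSpace 𝓧]
    (P Pstar : Measure Ω) [IsProbabilityMeasure P] [IsProbabilityMeasure Pstar]
    (D Y : Ω → ℝ) (X : Ω → 𝓧) (hD : Measurable D) (hY : Measurable Y) (hX : Measurable X)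
    (hDval : ∀ ω, D ω = 0 ∨ D ω = 1)
    (π πs : ℝ) (hπdef : π = (P {ω | D ω = 1}).toReal) (hπsdef : πs = (Pstar {ω | D ω = 1}).toReal)
    (hπ0 : 0 < π) (hπ1 : π < 1) (hπs0 : 0 < πs) (hπs1 : πs < 1)
    -- stratification: random sampling within each treatment stratum
    (hstrat : ∀ d ∈ ({0, 1} : Set ℝ), ∀ f : ℝ × 𝓧 → ℝ, Measurable f → (∃ C, ∀ p, |f p| ≤ C) →
      (∫ ω, (if D ω = d then (1 : ℝ) else 0) * f (Y ω, X ω) ∂P) / (P {ω | D ω = d}).toReal =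
        (∫ ω, (if D ω = d then (1 : ℝ) else 0) * f (Y ω, X ω) ∂Pstar) /
          (Pstar {ω | D ω = d}).toReal)
    -- potential outcomes
    (Y0 Y1 : Ω → ℝ) (hY0m : Measurable Y0) (hY1m : Measurable Y1)
    (hY0i : Integrable Y0 P) (hY1i : Integrable Y1 P)
    (hobs : ∀ ω, Y ω = D ω * Y1 ω + (1 - D ω) * Y0 ω)
    -- unconfoundedness: (Y₀, Y₁) ⫫ D | σ(X) under P
    (hunconf : CondIndepFun (MeasurableSpace.comap X inferInstance) hX.comap_le
      (fun ω => (Y0 ω, Y1 ω)) D P)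
    -- overlap: 0 < E_P[D | σ(X)] < 1 P-a.s.
    (hoverlap : ∀ᵐ ω ∂P, 0 < (P[D | MeasurableSpace.comap X inferInstance]) ω ∧
      (P[D | MeasurableSpace.comap X inferInstance]) ω < 1)
    -- β*₁, β*₀ : versions of E_{P*}[Y | D = 1, X] and E_{P*}[Y | D = 0, X]
    (β1 β0 : 𝓧 → ℝ) (hβ1m : Measurable β1) (hβ0m : Measurable β0)
    (hβ1i : Integrable (fun ω => β1 (X ω)) Pstar) (hβ0i : Integrable (fun ω => β0 (X ω)) Pstar)
    (hβ1iP : Integrable (fun ω => β1 (X ω)) P) (hβ0iP : Integrable (fun ω => β0 (X ω)) P)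
    (hβ1v : Pstar[fun ω => (if D ω = 1 then (1 : ℝ) else 0) * (Y ω - β1 (X ω)) |
      MeasurableSpace.comap X inferInstance] =ᵐ[Pstar] 0)
    (hβ0v : Pstar[fun ω => (if D ω = 0 then (1 : ℝ) else 0) * (Y ω - β0 (X ω)) |
      MeasurableSpace.comap X inferInstance] =ᵐ[Pstar] 0) :
    (∫ ω, D ω * (Y1 ω - Y0 ω) ∂P) / π =
      (∫ ω, D ω * (β1 (X ω) - β0 (X ω)) ∂Pstar) / πs ∧
    ∫ ω, (Y1 ω - Y0 ω) ∂P[|{ω | D ω = 1}] =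
      ∫ ω, (β1 (X ω) - β0 (X ω)) ∂Pstar[|{ω | D ω = 1}] := by
  have hmle : MeasurableSpace.comap X inferInstance ≤ (inferInstance : MeasurableSpace Ω) :=
    hX.comap_le
  set S1 : Set Ω := {ω | D ω = 1} with hS1d
  set S0 : Set Ω := {ω | D ω = 0} with hS0d
  have hS1 : MeasurableSet S1 := hD (measurableSet_singleton 1)
  have hS0 : MeasurableSet S0 := hD (measurableSet_singleton 0)
  have hc : S0 = S1ᶜ := by
    ext ω
    rcases hDval ω with h | h <;> simp [hS1d, hS0d, h]
  have hP1 : P S1 ≠ 0 := by intro h; simp [hπdef, h] at hπ0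
  have hQ1 : Pstar S1 ≠ 0 := by intro h; simp [hπsdef, h] at hπs0
  have hP0 : P S0 ≠ 0 := by
    intro h
    rw [hc, prob_compl_eq_zero_iff hS1] at h
    simp [hπdef, h] at hπ1
  have hQ0 : Pstar S0 ≠ 0 := by
    intro h
    rw [hc, prob_compl_eq_zero_iff hS1] at h
    simp [hπsdef, h] at hπs1
  have hite : ∀ (μ : Measure Ω) (d : ℝ) (g : Ω → ℝ),
      ∫ ω, (if D ω = d then (1 : ℝ) else 0) * g ω ∂μ = ∫ ω in {ω | D ω = d}, g ω ∂μ := by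
    intro μ d g
    have hd : MeasurableSet {ω | D ω = d} := hD (measurableSet_singleton d)
    rw [← integral_indicator hd]
    congr 1; ext ω; simp [Set.indicator]
  have hZ : Measurable (fun ω => (Y ω, X ω)) := hY.prodMk hX
  have T1 : (P[|S1]).map (fun ω => (Y ω, X ω)) = (Pstar[|S1]).map (fun ω => (Y ω, X ω)) := by
    refine aux_transfer_s5 P Pstar _ hZ S1 hS1 (fun f hf hb => ?_) hP1 hQ1
    have := hstrat 1 (by simp) f hf hb
    rwa [hite, hite] at this
  have T0 : (P[|S0]).map (fun ω => (Y ω, X ω)) = (Pstar[|S0]).map (fun ω => (Y ω, X ω)) := by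
    refine aux_transfer_s5 P Pstar _ hZ S0 hS0 (fun f hf hb => ?_) hP0 hQ0
    have := hstrat 0 (by simp) f hf hb
    rwa [hite, hite] at this
  have I1 : ∀ F : ℝ × 𝓧 → ℝ, Measurable F →
      ∫ ω, F (Y ω, X ω) ∂P[|S1] = ∫ ω, F (Y ω, X ω) ∂Pstar[|S1] := by
    intro F hF
    rw [← integral_map hZ.aemeasurable hF.aestronglyMeasurable, T1,
      integral_map hZ.aemeasurable hF.aestronglyMeasurable]
  have I0 : ∀ F : ℝ × 𝓧 → ℝ, Measurable F →
      ∫ ω, F (Y ω, X ω) ∂P[|S0] = ∫ ω, F (Y ω, X ω) ∂Pstar[|S0] := by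
    intro F hF
    rw [← integral_map hZ.aemeasurable hF.aestronglyMeasurable, T0,
      integral_map hZ.aemeasurable hF.aestronglyMeasurable]
  have hPs1 : (P S1).toReal ≠ 0 := by rw [← hπdef]; exact hπ0.ne'
  -- treated part
  have A1 : ∫ ω in S1, (Y1 ω - β1 (X ω)) ∂P = 0 := by
    have h1 : ∫ ω in S1, (Y ω - β1 (X ω)) ∂Pstar = 0 := by
      rw [hS1d, ← hite, ← integral_condExp hmle, integral_congr_ae hβ1v]; simp
    have h2 := I1 (fun p => p.1 - β1 p.2) (by fun_prop)
    simp only [aux_int_cond, h1, zero_div, div_eq_zero_iff, hPs1, or_false] at h2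
    rw [← h2]
    refine setIntegral_congr_fun hS1 fun ω hω => ?_
    have : D ω = 1 := hω
    simp [hobs, this]
  -- integrability
  have hY0int : IntegrableOn (fun ω => Y ω - β0 (X ω)) S0 P := by
    have : IntegrableOn (fun ω => Y0 ω - β0 (X ω)) S0 P := (hY0i.sub hβ0iP).integrableOn
    refine this.congr_fun (fun ω hω => ?_) hS0
    have : D ω = 0 := hω
    simp [hobs, this]
  have hY0intS : IntegrableOn (fun ω => Y ω - β0 (X ω)) S0 Pstar := by
    rw [← aux_integrable_cond _ _ hP0] at hY0int
    rw [← aux_integrable_cond _ _ hQ0]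
    have hF : Measurable (fun p : ℝ × 𝓧 => p.1 - β0 p.2) := by fun_prop
    have a := (integrable_map_measure (μ := P[|S0]) hF.aestronglyMeasurable hZ.aemeasurable).2
      hY0int
    rw [T0] at a
    exact (integrable_map_measure hF.aestronglyMeasurable hZ.aemeasurable).1 a
  have hD1 : ∀ ω, ‖D ω‖ ≤ 1 := by
    intro ω; rcases hDval ω with h | h <;> simp [h]
  have hDi : Integrable D P := Integrable.of_bound hD.aestronglyMeasurable 1 (ae_of_all _ hD1)
  have hg : Integrable (fun ω => Y0 ω - β0 (X ω)) P := hY0i.sub hβ0iP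
  have hDmul : ∀ g : Ω → ℝ, Integrable g P → Integrable (fun ω => g ω * D ω) P := fun g hg =>
    hg.mul_bdd hD.aestronglyMeasurable (ae_of_all _ hD1)
  -- control part: E[(1-D) g | X] = 0
  have B0 : P[fun ω => (Y0 ω - β0 (X ω)) - (Y0 ω - β0 (X ω)) * D ω |
      MeasurableSpace.comap X inferInstance] =ᵐ[P] 0 := by
    symm
    refine ae_eq_condExp_of_forall_setIntegral_eq hmle (hg.sub (hDmul _ hg))
      (fun s _ _ => integrableOn_zero) (fun s hs _ => ?_) aestronglyMeasurable_zero
    obtain ⟨T, hT, rfl⟩ := hs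
    have h1 : ∫ ω in X ⁻¹' T, (if D ω = 0 then (1 : ℝ) else 0) * (Y ω - β0 (X ω)) ∂Pstar = 0 := by
      rw [← setIntegral_condExp hmle ?_ ⟨T, hT, rfl⟩]
      · rw [integral_congr_ae (ae_restrict_of_ae hβ0v)]; simp
      · rw [← integrable_indicator_iff hS0] at hY0intS
        refine hY0intS.congr (ae_of_all _ fun ω => ?_)
        simp [Set.indicator, hS0d]
    have hF : Measurable (fun p : ℝ × 𝓧 => (T.indicator 1 p.2 : ℝ) * (p.1 - β0 p.2)) := by
      have : Measurable (T.indicator (1 : 𝓧 → ℝ)) := measurable_one.indicator hT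
      fun_prop
    have h2 := I0 _ hF
    have h3 : ∫ ω in S0, (T.indicator 1 (X ω) : ℝ) * (Y ω - β0 (X ω)) ∂Pstar = 0 := by
      rw [← h1, ← integral_indicator (hX hT), ← integral_indicator hS0]
      congr 1; ext ω
      by_cases a : X ω ∈ T <;> by_cases b : D ω = 0 <;> simp [Set.indicator, a, b, hS0d]
    have hPs0 : (P S0).toReal ≠ 0 := by
      rw [ENNReal.toReal_ne_zero]; exact ⟨hP0, by finiteness⟩
    simp only [aux_int_cond, h3, zero_div, div_eq_zero_iff, hPs0, or_false] at h2
    simp only [Pi.zero_apply, integral_zero]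
    rw [← h2, ← integral_indicator (hX hT), ← integral_indicator hS0]
    congr 1; ext ω
    by_cases a : X ω ∈ T <;> rcases hDval ω with b | b <;>
      simp [Set.indicator, a, b, hS0d, hobs]
  have hYD : CondIndepFun (MeasurableSpace.comap X inferInstance) hX.comap_le Y0 D P :=
    hunconf.comp (φ := Prod.fst) (ψ := id) measurable_fst measurable_id
  have C1 := aux_condExp_mul_s5 hX.comap_le hY0m hD hY0i hDi (hDmul _ hY0i) hYD
  have hbm : StronglyMeasurable[MeasurableSpace.comap X inferInstance] (fun ω => β0 (X ω)) :=
    (hβ0m.comp (comap_measurable X)).stronglyMeasurable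
  have C2 := condExp_mul_of_stronglyMeasurable_left (μ := P) (g := D) hbm (hDmul _ hβ0iP) hDi
  have C3 := condExp_sub (μ := P) (hDmul _ hY0i) (hDmul _ hβ0iP)
    (MeasurableSpace.comap X inferInstance)
  have C4 := condExp_sub (μ := P) hg (hDmul _ hg) (MeasurableSpace.comap X inferInstance)
  have C5 := condExp_sub (μ := P) hY0i hβ0iP (MeasurableSpace.comap X inferInstance)
  have C6 := condExp_of_stronglyMeasurable (μ := P) hmle hbm hβ0iP
  have e3 : (fun ω => (Y0 ω - β0 (X ω)) * D ω)
      = (fun ω => Y0 ω * D ω) - (fun ω => β0 (X ω) * D ω) := by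
    ext ω; simp [sub_mul]
  have G : P[fun ω => (Y0 ω - β0 (X ω)) * D ω | MeasurableSpace.comap X inferInstance]
      =ᵐ[P] 0 := by
    have C4' : P[fun ω => (Y0 ω - β0 (X ω)) - (Y0 ω - β0 (X ω)) * D ω |
      MeasurableSpace.comap X inferInstance] =ᵐ[P] _ := C4
    have C5' : P[fun ω => (Y0 ω - β0 (X ω)) |
      MeasurableSpace.comap X inferInstance] =ᵐ[P] _ := C5
    have C2' : P[fun ω => β0 (X ω) * D ω |
      MeasurableSpace.comap X inferInstance] =ᵐ[P] _ := C2
    rw [← e3] at C3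
    filter_upwards [B0, C1, C2', C3, C4', C5', hoverlap] with ω b c1 c2 c3 c4 c5 ho
    rw [b] at c4
    simp only [Pi.sub_apply, Pi.mul_apply, Pi.zero_apply] at *
    rw [C6] at c5
    rw [c1, c2] at c3
    rw [c5, c3] at c4
    rw [c3]
    have h0 : ((P[Y0 | MeasurableSpace.comap X inferInstance]) ω - β0 (X ω)) *
        (1 - (P[D | MeasurableSpace.comap X inferInstance]) ω) = 0 := by linarith
    rcases mul_eq_zero.1 h0 with h | h
    · rw [← sub_mul, h, zero_mul]
    · linarith [ho.2]
  have A0 : ∫ ω in S1, (Y0 ω - β0 (X ω)) ∂P = 0 := by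
    have : ∫ ω, (Y0 ω - β0 (X ω)) * D ω ∂P = 0 := by
      rw [← integral_condExp hmle, integral_congr_ae G]; simp
    rw [← this, ← integral_indicator hS1]
    congr 1; ext ω
    rcases hDval ω with b | b <;> simp [Set.indicator, b, hS1d]
  have main : ∫ ω, (Y1 ω - Y0 ω) ∂P[|S1] = ∫ ω, (β1 (X ω) - β0 (X ω)) ∂Pstar[|S1] := by
    rw [← I1 (fun p => β1 p.2 - β0 p.2) (by fun_prop)]
    simp only [aux_int_cond]
    congr 1
    rw [integral_sub hY1i.integrableOn hβ1iP.integrableOn] at A1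
    rw [integral_sub hY0i.integrableOn hβ0iP.integrableOn] at A0
    rw [integral_sub hY1i.integrableOn hY0i.integrableOn,
      integral_sub hβ1iP.integrableOn hβ0iP.integrableOn]
    linarith
  refine ⟨?_, main⟩
  have hDint : ∀ (μ : Measure Ω) (g : Ω → ℝ), ∫ ω, D ω * g ω ∂μ = ∫ ω in S1, g ω ∂μ := by
    intro μ g
    rw [← integral_indicator hS1]
    congr 1; ext ω
    rcases hDval ω with b | b <;> simp [Set.indicator, b, hS1d]
  rw [hDint, hDint, hπdef, hπsdef, ← aux_int_cond, ← aux_int_cond]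
  exact main
end

section
/- Let P be a probability measure with D : Ω → {0,1}, X : Ω → 𝒳, Y ∈ L¹(P), π := P(D=1) ∈ (0,1). Let π(X) be a version of E_P[D|σ(X)] satisfying c ≤ π(X) ≤ 1 − c P-almost surely for some c ∈ (0,1/2), and let β₁, β₀ be versions of E_P[Y|D=1,X] and E_P[Y|D=0,X] with β_d(X) ∈ L¹(P). Then the inverse-propensity-score expression identifies the average of the conditional treatment effect over the treated: (1/π)·E_P[ (D·Y/π(X) − (1−D)·Y/(1−π(X))) · π(X) ] = E_P[β₁(X) − β₀(X) | D=1]. -/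
open MeasureTheory ProbabilityTheory

theorem aux_zero {Ω : Type*} {m m0 : MeasurableSpace Ω} (hm : m ≤ m0)
    (P : Measure Ω) [IsProbabilityMeasure P] (f g : Ω → ℝ) (hf : Integrable f P)
    (hg : StronglyMeasurable[m] g) (hfg : Integrable (fun ω => f ω * g ω) P)
    (h0 : P[f | m] =ᵐ[P] 0) : ∫ ω, f ω * g ω ∂P = 0 := by
  have h1 := condExp_mul_of_stronglyMeasurable_right (μ := P) (m := m) hg hfg hf
  rw [← integral_condExp hm]
  apply integral_eq_zero_of_ae
  refine h1.trans ?_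
  filter_upwards [h0] with ω hω
  simp [hω]

/-- The inverse-propensity-score expression identifies the average of the
conditional treatment effect over the treated:
`(1/π)·E_P[(D·Y/π(X) − (1−D)·Y/(1−π(X)))·π(X)] = E_P[β₁(X) − β₀(X) | D=1]`. -/
theorem stmt_6 {Ω 𝓧 : Type*} [MeasurableSpace Ω] [MeasurableSpace 𝓧]
    (P : Measure Ω) [IsProbabilityMeasure P]
    (D Y : Ω → ℝ) (X : Ω → 𝓧) (hD : Measurable D) (hYm : Measurable Y) (hX : Measurable X)
    (hDval : ∀ ω, D ω = 0 ∨ D ω = 1) (hY : Integrable Y P)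
    (π : ℝ) (hπdef : π = (P {ω | D ω = 1}).toReal) (hπ0 : 0 < π) (hπ1 : π < 1)
    -- π(X) : a version of E_P[D | σ(X)], bounded away from 0 and 1
    (e : 𝓧 → ℝ) (hem : Measurable e)
    (he : P[D | MeasurableSpace.comap X inferInstance] =ᵐ[P] fun ω => e (X ω))
    (c : ℝ) (hc0 : 0 < c) (hc1 : c < 1 / 2)
    (hbound : ∀ᵐ ω ∂P, c ≤ e (X ω) ∧ e (X ω) ≤ 1 - c)
    -- β₁, β₀ : versions of E_P[Y | D = 1, X] and E_P[Y | D = 0, X]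
    (β1 β0 : 𝓧 → ℝ) (hβ1m : Measurable β1) (hβ0m : Measurable β0)
    (hβ1i : Integrable (fun ω => β1 (X ω)) P) (hβ0i : Integrable (fun ω => β0 (X ω)) P)
    (hβ1v : P[fun ω => (if D ω = 1 then (1 : ℝ) else 0) * (Y ω - β1 (X ω)) |
      MeasurableSpace.comap X inferInstance] =ᵐ[P] 0)
    (hβ0v : P[fun ω => (if D ω = 0 then (1 : ℝ) else 0) * (Y ω - β0 (X ω)) |
      MeasurableSpace.comap X inferInstance] =ᵐ[P] 0) :
    (1 / π) * ∫ ω, (D ω * Y ω / e (X ω) - (1 - D ω) * Y ω / (1 - e (X ω))) * e (X ω) ∂P =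
      ∫ ω, (β1 (X ω) - β0 (X ω)) ∂P[|{ω | D ω = 1}] := by
  have hm : MeasurableSpace.comap X inferInstance ≤ (inferInstance : MeasurableSpace Ω) :=
    hX.comap_le
  have hXm : Measurable[MeasurableSpace.comap X inferInstance] X := comap_measurable X
  have hif1 : ∀ ω, (if D ω = 1 then (1 : ℝ) else 0) = D ω := by
    intro ω; rcases hDval ω with h | h <;> simp [h]
  have hif0 : ∀ ω, (if D ω = 0 then (1 : ℝ) else 0) = 1 - D ω := by
    intro ω; rcases hDval ω with h | h <;> simp [h]
  simp only [hif1] at hβ1v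
  simp only [hif0] at hβ0v
  have hDb : ∀ᵐ ω ∂P, ‖D ω‖ ≤ 1 := Filter.Eventually.of_forall fun ω => by
    rcases hDval ω with h | h <;> simp [h]
  have hDb' : ∀ᵐ ω ∂P, ‖1 - D ω‖ ≤ 1 := Filter.Eventually.of_forall fun ω => by
    rcases hDval ω with h | h <;> simp [h]
  have hDi : Integrable D P := Integrable.of_bound hD.aestronglyMeasurable 1 hDb
  have hei : Integrable (fun ω => e (X ω)) P := integrable_condExp.congr he
  have i1 : Integrable (fun ω => D ω * (Y ω - β1 (X ω))) P :=
    (hY.sub hβ1i).bdd_mul hD.aestronglyMeasurable hDb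
  have i0 : Integrable (fun ω => (1 - D ω) * (Y ω - β0 (X ω))) P :=
    (hY.sub hβ0i).bdd_mul (measurable_const.sub hD).aestronglyMeasurable hDb'
  have iβ : Integrable (fun ω => D ω * (β1 (X ω) - β0 (X ω))) P :=
    (hβ1i.sub hβ0i).bdd_mul hD.aestronglyMeasurable hDb
  have hwm : Measurable fun x => e x / (1 - e x) := hem.div (measurable_const.sub hem)
  have hvm : Measurable fun x => β0 x / (1 - e x) := hβ0m.div (measurable_const.sub hem)
  have i0w : Integrable (fun ω => (1 - D ω) * (Y ω - β0 (X ω)) * (e (X ω) / (1 - e (X ω)))) P := by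
    refine i0.mul_bdd (c := 1 / c) (hwm.comp hX).aestronglyMeasurable ?_
    filter_upwards [hbound] with ω h
    have h1 : 0 < 1 - e (X ω) := by linarith
    have h2 : 0 ≤ e (X ω) := by linarith
    rw [Real.norm_of_nonneg (div_nonneg h2 h1.le)]
    exact div_le_div₀ (by norm_num) (by linarith) hc0 (by linarith)
  have iev : Integrable (fun ω => (e (X ω) - D ω) * (β0 (X ω) / (1 - e (X ω)))) P := by
    have : Integrable (fun ω => ((e (X ω) - D ω) / (1 - e (X ω))) * β0 (X ω)) P := by
      refine hβ0i.bdd_mul (c := 1 / c) (((hem.comp hX).sub hD).div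
        (measurable_const.sub (hem.comp hX))).aestronglyMeasurable ?_
      filter_upwards [hbound] with ω h
      have h1 : 0 < 1 - e (X ω) := by linarith
      rw [norm_div, Real.norm_of_nonneg h1.le]
      refine div_le_div₀ (by norm_num) ?_ hc0 (by linarith)
      rw [Real.norm_eq_abs, abs_le]
      rcases hDval ω with h | h <;> rw [h] <;> constructor <;> linarith
    refine this.congr (Filter.Eventually.of_forall fun ω => ?_)
    simp only
    ring
  have z1 : ∫ ω, D ω * (Y ω - β1 (X ω)) ∂P = 0 := by
    rw [← integral_condExp hm]
    exact integral_eq_zero_of_ae hβ1v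
  have z0 := aux_zero hm P _ (fun ω => e (X ω) / (1 - e (X ω))) i0
    (hwm.comp hXm).stronglyMeasurable i0w hβ0v
  have hce : P[fun ω => e (X ω) - D ω | MeasurableSpace.comap X inferInstance] =ᵐ[P] 0 := by
    have h1 := condExp_sub hei hDi (MeasurableSpace.comap X inferInstance)
    have h2 : P[fun ω => e (X ω) | MeasurableSpace.comap X inferInstance]
        = fun ω => e (X ω) :=
      condExp_of_stronglyMeasurable hm (hem.comp hXm).stronglyMeasurable hei
    refine Filter.EventuallyEq.trans h1 ?_
    filter_upwards [he] with ω hω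
    simp [h2, hω]
  have ze := aux_zero hm P (fun ω => e (X ω) - D ω) (fun ω => β0 (X ω) / (1 - e (X ω)))
    (hei.sub hDi) (hvm.comp hXm).stronglyMeasurable iev hce
  have hL : ∫ ω, (D ω * Y ω / e (X ω) - (1 - D ω) * Y ω / (1 - e (X ω))) * e (X ω) ∂P
      = ∫ ω, D ω * (β1 (X ω) - β0 (X ω)) ∂P := by
    have h1 : ∫ ω, (D ω * Y ω / e (X ω) - (1 - D ω) * Y ω / (1 - e (X ω))) * e (X ω) ∂P
      = ∫ ω, (((D ω * (β1 (X ω) - β0 (X ω)) + D ω * (Y ω - β1 (X ω)))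
        - (1 - D ω) * (Y ω - β0 (X ω)) * (e (X ω) / (1 - e (X ω))))
        - (e (X ω) - D ω) * (β0 (X ω) / (1 - e (X ω)))) ∂P := by
      apply integral_congr_ae
      filter_upwards [hbound] with ω h
      have h1 : 1 - e (X ω) ≠ 0 := by linarith
      have h2 : e (X ω) ≠ 0 := by linarith
      field_simp
      ring
    rw [h1, integral_sub (by exact (iβ.add i1).sub i0w) iev, integral_sub (by exact iβ.add i1) i0w,
      integral_add iβ i1, z1, z0, ze]
    ring
  have hS : MeasurableSet {ω | D ω = 1} := hD (measurableSet_singleton 1)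
  rw [hL, ProbabilityTheory.cond, integral_smul_measure, ENNReal.toReal_inv, ← hπdef,
    ← integral_indicator hS, one_div, smul_eq_mul]
  congr 1
  apply integral_congr_ae
  refine Filter.Eventually.of_forall fun ω => ?_
  rcases hDval ω with h | h <;> simp [Set.indicator, h]
end

section
/- Under the stratification assumption, with Y integrable under both P and P*, any version β*_d of E_{P*}[Y|D=d,X] (with β*_d(X) integrable under both P and P*) is also a version of E_P[Y|D=d,X]: for every bounded measurable g : 𝒳 → ℝ and d ∈ {0,1}, E_P[1{D=d}·Y·g(X)] = E_P[1{D=d}·β*_d(X)·g(X)]. Consequently the conditional average treatment effect computed from the stratified sample, β*₁(X) − β*₀(X), is a version of the population conditional average treatment effect. -/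
open MeasureTheory

/-- Under the stratification assumption, any version `β*_d` of
`E_{P*}[Y | D = d, X]` is also a version of `E_P[Y | D = d, X]`: for every bounded measurable
`g : 𝒳 → ℝ` and `d ∈ {0,1}`, `E_P[1{D=d}·Y·g(X)] = E_P[1{D=d}·β*_d(X)·g(X)]`. Consequently the
conditional average treatment effect `β*₁(X) − β*₀(X)` computed from the stratified sample is a
version of the population conditional average treatment effect. -/
theorem stmt_7 {Ω 𝓧 : Type*} [MeasurableSpace Ω] [MeasurableSpace 𝓧]
    (P Pstar : Measure Ω) [IsProbabilityMeasure P] [IsProbabilityMeasure Pstar]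
    (D Y : Ω → ℝ) (X : Ω → 𝓧) (hD : Measurable D) (hYm : Measurable Y) (hX : Measurable X)
    (hDval : ∀ ω, D ω = 0 ∨ D ω = 1)
    (π πs : ℝ) (hπdef : π = (P {ω | D ω = 1}).toReal) (hπsdef : πs = (Pstar {ω | D ω = 1}).toReal)
    (hπ0 : 0 < π) (hπ1 : π < 1) (hπs0 : 0 < πs) (hπs1 : πs < 1)
    (hYiP : Integrable Y P) (hYiPstar : Integrable Y Pstar)
    -- stratification: random sampling within each treatment stratum
    (hstrat : ∀ d ∈ ({0, 1} : Set ℝ), ∀ f : ℝ × 𝓧 → ℝ, Measurable f → (∃ C, ∀ p, |f p| ≤ C) →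
      (∫ ω, (if D ω = d then (1 : ℝ) else 0) * f (Y ω, X ω) ∂P) / (P {ω | D ω = d}).toReal =
        (∫ ω, (if D ω = d then (1 : ℝ) else 0) * f (Y ω, X ω) ∂Pstar) /
          (Pstar {ω | D ω = d}).toReal) :
    ∀ d ∈ ({0, 1} : Set ℝ), ∀ βd : 𝓧 → ℝ, Measurable βd →
      Integrable (fun ω => βd (X ω)) Pstar → Integrable (fun ω => βd (X ω)) P →
      -- βd is a version of E_{P*}[Y | D = d, X]
      (Pstar[fun ω => (if D ω = d then (1 : ℝ) else 0) * (Y ω - βd (X ω)) |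
        MeasurableSpace.comap X inferInstance] =ᵐ[Pstar] 0) →
      -- then βd is also a version of E_P[Y | D = d, X]
      ∀ g : 𝓧 → ℝ, Measurable g → (∃ C, ∀ x, |g x| ≤ C) →
        ∫ ω, (if D ω = d then (1 : ℝ) else 0) * Y ω * g (X ω) ∂P =
          ∫ ω, (if D ω = d then (1 : ℝ) else 0) * βd (X ω) * g (X ω) ∂P := by
  intro d hd β hβ hβs hβP hce g hg ⟨C, hC⟩
  have hset : ∀ d : ℝ, MeasurableSet {ω | D ω = d} := fun d => hD (measurableSet_singleton d)
  have hpos : ∀ Q : Measure Ω, IsProbabilityMeasure Q → 0 < (Q {ω | D ω = 1}).toReal →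
      (Q {ω | D ω = 1}).toReal < 1 → 0 < (Q {ω | D ω = d}).toReal := by
    intro Q hQ h0 h1
    rcases hd with rfl | rfl
    · have hc : {ω | D ω = 0} = {ω | D ω = 1}ᶜ := by
        ext ω
        rcases hDval ω with h | h <;> simp [h]
      have := probReal_compl_eq_one_sub (μ := Q) (hset 1)
      simp only [Measure.real] at this
      rw [hc, this]
      linarith
    · exact h0
  have hp := hpos P inferInstance (hπdef ▸ hπ0) (hπdef ▸ hπ1)
  have hps := hpos Pstar inferInstance (hπsdef ▸ hπs0) (hπsdef ▸ hπs1)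
  set p := (P {ω | D ω = d}).toReal with hpdef
  set ps := (Pstar {ω | D ω = d}).toReal with hpsdef
  have hYX : Measurable (fun ω => (Y ω, X ω)) := hYm.prodMk hX
  have hint : ∀ (Q : Measure Ω) (h : Ω → ℝ),
      ∫ ω, (if D ω = d then (1 : ℝ) else 0) * h ω ∂Q = ∫ ω in {ω | D ω = d}, h ω ∂Q := by
    intro Q h
    rw [← integral_indicator (hset d)]
    congr 1
    ext ω
    by_cases hω : D ω = d <;> simp [Set.indicator, hω]
  have hmu : (P.restrict {ω | D ω = d}).map (fun ω => (Y ω, X ω)) =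
      ENNReal.ofReal (p / ps) • (Pstar.restrict {ω | D ω = d}).map (fun ω => (Y ω, X ω)) := by
    ext A hA
    have h := hstrat d hd (A.indicator 1) (measurable_one.indicator hA)
      ⟨1, fun q => by by_cases hq : q ∈ A <;> simp [hq]⟩
    rw [hint, hint] at h
    have key : ∀ (Q : Measure Ω) [IsProbabilityMeasure Q],
        ∫ ω in {ω | D ω = d}, A.indicator (1 : ℝ × 𝓧 → ℝ) (Y ω, X ω) ∂Q =
          (((Q.restrict {ω | D ω = d}).map (fun ω => (Y ω, X ω))) A).toReal := by
      intro Q _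
      rw [← integral_map (φ := fun ω => (Y ω, X ω)) hYX.aemeasurable
        (f := A.indicator (1 : ℝ × 𝓧 → ℝ))
        (measurable_one.indicator hA).aestronglyMeasurable, integral_indicator_one hA]
      rfl
    rw [key, key] at h
    rw [← ENNReal.toReal_eq_toReal_iff' (measure_ne_top _ _)
      (by simpa using ENNReal.mul_ne_top ENNReal.ofReal_ne_top (measure_ne_top _ _))]
    rw [Measure.smul_apply, smul_eq_mul, ENNReal.toReal_mul, ENNReal.toReal_ofReal (by positivity)]
    rw [← hpdef, ← hpsdef] at h
    field_simp at h ⊢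
    linarith
  have hF : Measurable (fun q : ℝ × 𝓧 => (q.1 - β q.2) * g q.2) := by fun_prop
  have htrans : ∫ ω in {ω | D ω = d}, (Y ω - β (X ω)) * g (X ω) ∂P =
      (p / ps) * ∫ ω in {ω | D ω = d}, (Y ω - β (X ω)) * g (X ω) ∂Pstar := by
    have h1 := integral_map (μ := P.restrict {ω | D ω = d}) hYX.aemeasurable
      hF.aestronglyMeasurable
    have h2 := integral_map (μ := Pstar.restrict {ω | D ω = d}) hYX.aemeasurable
      hF.aestronglyMeasurable
    rw [hmu, integral_smul_measure, h2, ENNReal.toReal_ofReal (by positivity)] at h1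
    simpa using h1.symm
  have hgb : ∀ (Q : Measure Ω), ∀ᵐ ω ∂Q, ‖g (X ω)‖ ≤ C := fun Q =>
    Filter.Eventually.of_forall fun ω => hC _
  have hgX : Measurable (fun ω => g (X ω)) := hg.comp hX
  have hstar : ∫ ω in {ω | D ω = d}, (Y ω - β (X ω)) * g (X ω) ∂Pstar = 0 := by
    rw [← hint]
    have hle : MeasurableSpace.comap X inferInstance ≤ (inferInstance : MeasurableSpace Ω) :=
      hX.comap_le
    have hi : Integrable (fun ω => (if D ω = d then (1 : ℝ) else 0) * (Y ω - β (X ω))) Pstar := by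
      have := (hYiPstar.sub hβs).indicator (hset d)
      refine this.congr (Filter.Eventually.of_forall fun ω => ?_)
      by_cases hω : D ω = d <;> simp [Set.indicator, hω]
    have hgs : StronglyMeasurable[MeasurableSpace.comap X inferInstance] (fun ω => g (X ω)) :=
      (hg.comp (comap_measurable X)).stronglyMeasurable
    have hig := hi.mul_bdd hgX.aestronglyMeasurable (hgb _)
    have hc := condExp_mul_of_stronglyMeasurable_right hgs hig hi
    have h3 := integral_condExp (μ := Pstar) hle
      (f := (fun ω => (if D ω = d then (1 : ℝ) else 0) * (Y ω - β (X ω))) * fun ω => g (X ω))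
    have h4 : ∫ ω, (if D ω = d then (1 : ℝ) else 0) * ((Y ω - β (X ω)) * g (X ω)) ∂Pstar =
      ∫ ω, ((fun ω => (if D ω = d then (1 : ℝ) else 0) * (Y ω - β (X ω))) *
        fun ω => g (X ω)) ω ∂Pstar := by
      simp only [Pi.mul_apply, mul_assoc]
    rw [h4, ← h3, integral_congr_ae hc]
    apply integral_eq_zero_of_ae
    filter_upwards [hce] with ω hω
    rw [Pi.mul_apply, hω, Pi.zero_apply, zero_mul]
  rw [hstar, mul_zero] at htrans
  simp only [mul_assoc]
  rw [hint, hint, ← sub_eq_zero, ← integral_sub, ← htrans]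
  · simp only [sub_mul]
  · exact (hYiP.mul_bdd hgX.aestronglyMeasurable (hgb _)).integrableOn
  · exact (hβP.mul_bdd hgX.aestronglyMeasurable (hgb _)).integrableOn
end
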